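/- arXiv:1112.4226 — 2 statements merged into one kernel-verified Lean document; each statement's English description precedes it below -/
import Mathlib

section
/- Bessel transform identity for Kirillov vectors (action of the Weyl element): let ν ∈ ℂ with |Re ν| < 1/2 and ν ≠ 0, let ℓ ∈ ℤ and u ∈ ℝ ∖ {0}. Then (−1)^ℓ · 𝒦_ℓ(u,ν) = ∫_{ℝ∖{0}} j_ν(uλ) · 𝒦_ℓ(λ,ν) · dλ/|λ|, the integral converging absolutely. -/
open MeasureTheory

/-- The Kirillov vector 𝒦_ℓ(u,ν), the value at a[|u|] of the Jacquet transform 𝒜^{sgn u}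
of the weight-2ℓ weight function on SL(2,ℝ). -/
noncomputable def Kvec (ℓ : ℤ) (ν : ℂ) (u : ℝ) : ℂ :=
  (Real.pi : ℂ) ^ ν / Complex.Gamma (ν + (ℓ.natAbs : ℂ) + 1 / 2) *
    ∑ j ∈ Finset.range (ℓ.natAbs + 1),
      (-(Real.pi : ℂ)) ^ j * ((2 * ℓ.natAbs).choose (2 * j) : ℂ) *
        Complex.Gamma ((ℓ.natAbs : ℂ) - (j : ℂ) + 1 / 2) * ((|u| : ℝ) : ℂ) ^ ((j : ℂ) + 1 / 2) *
        ∫ t in Set.Ioi (0 : ℝ),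
          (t : ℂ) ^ (ν - 1) *
            (((Real.sqrt t + Real.sign (u * (ℓ : ℝ)) / Real.sqrt t) ^ (2 * j) : ℝ) : ℂ) *
            (Real.exp (-(Real.pi * |u| * (t + 1 / t))) : ℂ)

/-- The power series Σ_k ε^k (x/2)^{μ+2k}/(k!·Γ(μ+k+1)); with ε = −1 this is J_μ(x)
and with ε = +1 it is I_μ(x) (for x > 0, powers via the real logarithm of x/2). -/
noncomputable def besselSeries (μ : ℂ) (ε : ℝ) (x : ℝ) : ℂ :=
  ∑' k : ℕ, (ε : ℂ) ^ k * ((x / 2 : ℝ) : ℂ) ^ (μ + 2 * (k : ℂ)) /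
    ((k.factorial : ℂ) * Complex.Gamma (μ + (k : ℂ) + 1))

/-- The Bessel function of representation: for λ ∈ ℝ ∖ {0},
j_ν(λ) = (π√|λ|/sin(πν)) (𝔅_{−2ν}(λ) − 𝔅_{2ν}(λ)), where 𝔅_μ(λ) = J_μ(4π√λ) for λ > 0
and 𝔅_μ(λ) = I_μ(4π√|λ|) for λ < 0. -/
noncomputable def besselRep (ν : ℂ) (lam : ℝ) : ℂ :=
  (Real.pi : ℂ) * ((Real.sqrt |lam| : ℝ) : ℂ) / Complex.sin ((Real.pi : ℂ) * ν) *
    (besselSeries (-2 * ν) (if 0 < lam then -1 else 1) (4 * Real.pi * Real.sqrt |lam|) -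
      besselSeries (2 * ν) (if 0 < lam then -1 else 1) (4 * Real.pi * Real.sqrt |lam|))

/-- The entire function `z ↦ Σ z ^ n / (n! Γ(μ + n + 1))` (a normalised `₀F₁`), through which
all Bessel functions in this file are expressed. -/
noncomputable def besselEntire (μ z : ℂ) : ℂ :=
  ∑' n : ℕ, z ^ n / ((n.factorial : ℂ) * Complex.Gamma (μ + n + 1))

lemma inv_Gamma_succ (s : ℂ) : (Complex.Gamma s)⁻¹ = s * (Complex.Gamma (s + 1))⁻¹ :=
  Complex.one_div_Gamma_eq_self_mul_one_div_Gamma_add_one s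

lemma exists_norm_inv_Gamma_le (μ : ℂ) {ε : ℝ} (hε : 0 < ε) :
    ∃ C : ℝ, 0 ≤ C ∧ ∀ n : ℕ, ‖(Complex.Gamma (μ + n + 1))⁻¹‖ ≤ C * ε ^ n := by
  have hev : ∀ᶠ n : ℕ in Filter.atTop, 0 < (μ + n + 1).re := by
    have : Filter.Tendsto (fun n : ℕ => (n : ℝ)) Filter.atTop Filter.atTop :=
      tendsto_natCast_atTop_atTop
    filter_upwards [this.eventually_gt_atTop (-μ.re)] with n hn
    simp
    linarith
  have hsum : Summable fun n : ℕ => (Complex.Gamma (μ + n + 1))⁻¹ / (ε : ℂ) ^ n := by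
    refine summable_of_ratio_test_tendsto_lt_one (l := 0) zero_lt_one ?_ ?_
    · filter_upwards [hev] with n hn
      have := Complex.Gamma_ne_zero_of_re_pos hn
      have hε' : (ε : ℂ) ≠ 0 := by exact_mod_cast hε.ne'
      positivity
    · have hlim : Filter.Tendsto (fun n : ℕ => ‖μ + n + 1‖ * ε) Filter.atTop Filter.atTop := by
        refine Filter.Tendsto.atTop_mul_const hε ?_
        refine Filter.tendsto_atTop_mono (f := fun n : ℕ => (n : ℝ) + (μ.re + 1)) (fun n => ?_) ?_
        · refine le_trans (le_of_eq ?_) (Complex.re_le_norm _)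
          simp; ring
        · exact Filter.tendsto_atTop_add_const_right _ _ tendsto_natCast_atTop_atTop
      refine (hlim.inv_tendsto_atTop).congr' ?_
      filter_upwards [hev] with n hn
      have h1 := Complex.Gamma_ne_zero_of_re_pos hn
      have h0 : μ + n + 1 ≠ 0 := by
        intro h; rw [h] at hn; simp at hn
      have h2 := Complex.Gamma_add_one _ h0
      have h3 : μ + ((n + 1 : ℕ) : ℂ) + 1 = μ + n + 1 + 1 := by push_cast; ring
      rw [h3, h2]
      have h4 : ‖Complex.Gamma (μ + n + 1)‖ ≠ 0 := by simpa using h1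
      have h5 : ‖μ + n + 1‖ ≠ 0 := by simpa using h0
      simp only [Pi.inv_apply, norm_div, norm_inv, norm_mul, norm_pow, Complex.norm_real,
        Real.norm_eq_abs, abs_of_pos hε]
      field_simp
      ring
  refine ⟨∑' n : ℕ, ‖(Complex.Gamma (μ + n + 1))⁻¹ / (ε : ℂ) ^ n‖,
    tsum_nonneg fun _ => norm_nonneg _, fun n => ?_⟩
  have h := hsum.norm.le_tsum n (fun _ _ => norm_nonneg _)
  rw [norm_div, norm_pow, Complex.norm_real, Real.norm_eq_abs, abs_of_pos hε] at h
  rwa [div_le_iff₀ (by positivity)] at h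

lemma exists_norm_besselEntire_term_le (μ : ℂ) {ε : ℝ} (hε : 0 < ε) :
    ∃ C : ℝ, 0 ≤ C ∧ ∀ (n : ℕ) (z : ℂ),
      ‖z ^ n / ((n.factorial : ℂ) * Complex.Gamma (μ + n + 1))‖ ≤
        C * ((ε * ‖z‖) ^ n / n.factorial) := by
  obtain ⟨C, hC, h⟩ := exists_norm_inv_Gamma_le μ hε
  refine ⟨C, hC, fun n z => ?_⟩
  rw [div_eq_mul_inv, mul_inv, norm_mul, norm_mul, norm_pow, norm_inv, Complex.norm_natCast]
  calc ‖z‖ ^ n * ((n.factorial : ℝ)⁻¹ * ‖(Complex.Gamma (μ + n + 1))⁻¹‖)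
      ≤ ‖z‖ ^ n * ((n.factorial : ℝ)⁻¹ * (C * ε ^ n)) := by gcongr; exact h n
    _ = C * ((ε * ‖z‖) ^ n / n.factorial) := by rw [mul_pow]; ring

lemma hasSum_besselEntire (μ z : ℂ) :
    HasSum (fun n : ℕ => z ^ n / ((n.factorial : ℂ) * Complex.Gamma (μ + n + 1)))
      (besselEntire μ z) := by
  obtain ⟨C, hC, h⟩ := exists_norm_besselEntire_term_le μ one_pos
  exact (Summable.of_norm_bounded ((Real.summable_pow_div_factorial _).mul_left C)
    (fun n => h n z)).hasSum

lemma exists_norm_besselEntire_le (μ : ℂ) {ε : ℝ} (hε : 0 < ε) :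
    ∃ C : ℝ, 0 ≤ C ∧ ∀ z : ℂ, ‖besselEntire μ z‖ ≤ C * Real.exp (ε * ‖z‖) := by
  obtain ⟨C, hC, h⟩ := exists_norm_besselEntire_term_le μ hε
  refine ⟨C, hC, fun z => ?_⟩
  refine tsum_of_norm_bounded ?_ (fun n => h n z)
  rw [Real.exp_eq_exp_ℝ]
  exact (NormedSpace.expSeries_div_hasSum_exp (ε * ‖z‖)).mul_left C

lemma hasSum_besselEntire_deriv (μ z : ℂ) :
    HasSum (fun n : ℕ => n * z ^ (n - 1) / ((n.factorial : ℂ) * Complex.Gamma (μ + n + 1)))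
      (besselEntire (μ + 1) z) := by
  rw [← hasSum_nat_add_iff' 1]
  simp only [Finset.range_one, Finset.sum_singleton, Nat.cast_zero, zero_mul, zero_div, sub_zero]
  refine (hasSum_besselEntire (μ + 1) z).congr_fun fun n => ?_
  have h1 : ((n : ℂ) + 1) ≠ 0 := by exact_mod_cast n.succ_ne_zero
  have h2 : (n.factorial : ℂ) ≠ 0 := by exact_mod_cast n.factorial_ne_zero
  rw [Nat.factorial_succ, Nat.add_sub_cancel]
  push_cast
  rw [show μ + (n + 1) + 1 = μ + 1 + n + 1 by ring, mul_assoc, mul_div_mul_left _ _ h1]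

lemma hasDerivAt_besselEntire (μ z : ℂ) :
    HasDerivAt (besselEntire μ) (besselEntire (μ + 1) z) z := by
  obtain ⟨C, hC, h⟩ := exists_norm_besselEntire_term_le μ one_pos
  set F : ℕ → ℂ → ℂ := fun n z => z ^ n / ((n.factorial : ℂ) * Complex.Gamma (μ + n + 1)) with hF
  have hu : Summable fun n : ℕ => C * ((‖z‖ + 1) ^ n / n.factorial) :=
    (Real.summable_pow_div_factorial _).mul_left C
  have hd : ∀ n, Differentiable ℂ (F n) := fun n => by simp only [hF]; fun_prop
  have hle : ∀ (n : ℕ) (w : ℂ), w ∈ Metric.ball (0 : ℂ) (‖z‖ + 1) →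
      ‖F n w‖ ≤ C * ((‖z‖ + 1) ^ n / n.factorial) := fun n w hw => by
    refine (h n w).trans ?_
    rw [mem_ball_zero_iff] at hw
    rw [one_mul]
    gcongr
  have hz : z ∈ Metric.ball (0 : ℂ) (‖z‖ + 1) := by simp
  have h1 := Complex.hasSum_deriv_of_summable_norm hu (fun n => (hd n).differentiableOn)
    Metric.isOpen_ball hle hz
  have h2 := (Complex.differentiableOn_tsum_of_summable_norm hu
    (fun n => (hd n).differentiableOn) Metric.isOpen_ball hle).differentiableAt
    (Metric.isOpen_ball.mem_nhds hz)
  have h3 : deriv (fun w => ∑' n, F n w) z = besselEntire (μ + 1) z := by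
    refine h1.unique ((hasSum_besselEntire_deriv μ z).congr_fun fun n => ?_)
    simp [hF]
  rw [← h3]
  exact h2.hasDerivAt

lemma besselEntire_eq (μ z : ℂ) :
    besselEntire μ z = (μ + 1) * besselEntire (μ + 1) z + z * besselEntire (μ + 2) z := by
  have h1 := ((hasSum_besselEntire (μ + 1) z).mul_left (μ + 1)).add
    ((hasSum_besselEntire_deriv (μ + 1) z).mul_left z)
  rw [show μ + 1 + 1 = μ + 2 by ring] at h1
  refine (hasSum_besselEntire μ z).unique (h1.congr_fun fun n => ?_)
  rw [div_eq_mul_inv, mul_inv, inv_Gamma_succ (μ + n + 1)]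
  rw [show μ + n + 1 + 1 = μ + 1 + n + 1 by ring]
  rcases n with _ | n
  · simp
  · simp only [Nat.add_sub_cancel, pow_succ]
    push_cast
    ring

lemma continuous_besselEntire (μ : ℂ) : Continuous (besselEntire μ) :=
  continuous_iff_continuousAt.mpr fun z => (hasDerivAt_besselEntire μ z).continuousAt

lemma besselEntire_zero (μ : ℂ) : besselEntire μ 0 = (Complex.Gamma (μ + 1))⁻¹ := by
  rw [besselEntire, tsum_eq_single 0]
  · simp
  · intro n hn; simp [hn]

lemma besselEntire_wronskian (ν : ℂ) (hν : |ν.re| < 1) (hν0 : ν ≠ 0) (z : ℂ) :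
    ν * besselEntire ν z * besselEntire (-ν) z +
      z * (besselEntire (ν + 1) z * besselEntire (-ν) z -
        besselEntire (-ν + 1) z * besselEntire ν z) = Complex.sin (Real.pi * ν) / Real.pi := by
  have hd : ∀ z : ℂ, HasDerivAt (fun z => ν * besselEntire ν z * besselEntire (-ν) z +
      z * (besselEntire (ν + 1) z * besselEntire (-ν) z -
        besselEntire (-ν + 1) z * besselEntire ν z)) 0 z := by
    intro z
    have h1 := hasDerivAt_besselEntire ν z
    have h2 := hasDerivAt_besselEntire (-ν) z
    have h3 := hasDerivAt_besselEntire (ν + 1) z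
    have h4 := hasDerivAt_besselEntire (-ν + 1) z
    have h := ((h1.const_mul ν).mul h2).add
      ((hasDerivAt_id z).mul ((h3.mul h2).sub (h4.mul h1)))
    refine h.congr_deriv ?_
    have e1 := besselEntire_eq ν z
    have e2 := besselEntire_eq (-ν) z
    rw [show ν + 1 + 1 = ν + 2 by ring, show -ν + 1 + 1 = -ν + 2 by ring]
    simp only [Pi.mul_apply, Pi.sub_apply, id]
    linear_combination besselEntire ν z * e2 - besselEntire (-ν) z * e1
  have hc := is_const_of_deriv_eq_zero (fun z => (hd z).differentiableAt)
    (fun z => (hd z).deriv) z 0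
  refine hc.trans ?_
  simp only [besselEntire_zero, zero_mul, add_zero]
  have hG := Complex.Gamma_mul_Gamma_one_sub ν
  have h1 := Complex.Gamma_add_one ν hν0
  have hre := abs_lt.mp hν
  have hs : Complex.Gamma (1 - ν) ≠ 0 :=
    Complex.Gamma_ne_zero_of_re_pos (by simp; linarith)
  have hs' : Complex.Gamma (ν + 1) ≠ 0 :=
    Complex.Gamma_ne_zero_of_re_pos (by simp; linarith)
  have hs2 : Complex.Gamma ν ≠ 0 := by
    intro h; rw [h1, h, mul_zero] at hs'; exact hs' rfl
  have hpi : (Real.pi : ℂ) ≠ 0 := by exact_mod_cast Real.pi_ne_zero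
  have hsin : Complex.sin (Real.pi * ν) ≠ 0 := by
    intro h
    rw [h, div_zero] at hG
    exact mul_ne_zero hs2 hs hG
  rw [h1, show -ν + 1 = 1 - ν by ring]
  rw [eq_div_iff hsin] at hG
  field_simp
  rw [mul_comm ν]
  linear_combination (-1 : ℂ) * hG

lemma integrableOn_cpow_mul_exp (a : ℂ) {c d : ℝ} (hc : 0 < c) (hd : 0 < d) :
    IntegrableOn (fun t : ℝ => (t : ℂ) ^ (a - 1) * (Real.exp (-(c * t + d / t)) : ℂ))
      (Set.Ioi 0) := by
  obtain ⟨N, hN⟩ := exists_nat_gt (-a.re)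
  have hg : IntegrableOn (fun t : ℝ => N.factorial / d ^ N *
      (t ^ (a.re - 1 + N) * Real.exp (-c * t ^ (1 : ℝ)))) (Set.Ioi 0) :=
    (integrableOn_rpow_mul_exp_neg_mul_rpow (by linarith) one_pos hc).const_mul _
  refine Integrable.mono' hg ?_ ?_
  · refine ContinuousOn.aestronglyMeasurable (fun t ht => ?_) measurableSet_Ioi
    have ht' : (0 : ℝ) < t := ht
    refine ContinuousAt.continuousWithinAt (ContinuousAt.mul ?_ ?_)
    · exact Complex.continuousAt_ofReal_cpow_const _ _ (Or.inr ht'.ne')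
    · have : ContinuousAt (fun t : ℝ => Real.exp (-(c * t + d / t))) t := by
        fun_prop (disch := exact ht'.ne')
      exact Complex.continuous_ofReal.continuousAt.comp this
  · filter_upwards [ae_restrict_mem measurableSet_Ioi] with t ht
    have ht' : (0 : ℝ) < t := ht
    rw [norm_mul, Complex.norm_cpow_eq_rpow_re_of_pos ht', Complex.norm_real, Real.norm_eq_abs,
      abs_of_pos (Real.exp_pos _), Complex.sub_re, Complex.one_re, neg_add, Real.exp_add,
      Real.rpow_one, Real.rpow_add ht', Real.rpow_natCast]
    have h1 := Real.pow_div_factorial_le_exp (d / t) (by positivity) N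
    have h2 : Real.exp (-(d / t)) ≤ N.factorial / d ^ N * t ^ N := by
      rw [Real.exp_neg, inv_le_comm₀ (Real.exp_pos _) (by positivity)]
      refine le_trans (le_of_eq ?_) h1
      rw [div_pow]
      field_simp
    calc t ^ (a.re - 1) * (Real.exp (-(c * t)) * Real.exp (-(d / t)))
        ≤ t ^ (a.re - 1) * (Real.exp (-(c * t)) * (N.factorial / d ^ N * t ^ N)) := by gcongr
      _ = _ := by rw [neg_mul]; ring

lemma hasDerivAt_integral_exp_neg_mul (w : ℝ → ℂ) (ψ : ℝ → ℝ) (hψ : ∀ t, 0 < t → 0 ≤ ψ t)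
    (h0 : ∀ x, 0 < x → IntegrableOn (fun t => w t * (Real.exp (-(x * ψ t)) : ℂ)) (Set.Ioi 0))
    (h1 : ∀ x, 0 < x →
      IntegrableOn (fun t => ψ t * w t * (Real.exp (-(x * ψ t)) : ℂ)) (Set.Ioi 0))
    {x : ℝ} (hx : 0 < x) :
    HasDerivAt (fun x : ℝ => ∫ t in Set.Ioi (0 : ℝ), w t * (Real.exp (-(x * ψ t)) : ℂ))
      (-∫ t in Set.Ioi (0 : ℝ), ψ t * w t * (Real.exp (-(x * ψ t)) : ℂ)) x := by
  rw [← integral_neg]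
  refine (hasDerivAt_integral_of_dominated_loc_of_deriv_le
    (F := fun (x : ℝ) t => w t * (Real.exp (-(x * ψ t)) : ℂ))
    (F' := fun (x : ℝ) t => -(ψ t * w t * (Real.exp (-(x * ψ t)) : ℂ)))
    (bound := fun t => ‖ψ t * w t * (Real.exp (-(x / 2 * ψ t)) : ℂ)‖)
    (s := Set.Ioi (x / 2)) (Ioi_mem_nhds (by linarith)) ?_ (h0 x hx)
    (h1 x hx).neg.aestronglyMeasurable ?_ (h1 (x / 2) (by linarith)).norm ?_).2
  · filter_upwards [Ioi_mem_nhds hx] with y hy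
    exact (h0 y hy).aestronglyMeasurable
  · filter_upwards [ae_restrict_mem measurableSet_Ioi] with t ht y hy
    rw [norm_neg, norm_mul, norm_mul (_ * _)]
    simp only [Complex.norm_real, Real.norm_eq_abs, Real.abs_exp]
    have := hψ t ht
    have hy' : x / 2 < y := hy
    gcongr
  · refine Filter.Eventually.of_forall fun t y _ => ?_
    have h : HasDerivAt (fun x : ℝ => Real.exp (-(x * ψ t))) (Real.exp (-(y * ψ t)) * -(1 * ψ t)) y :=
      (((hasDerivAt_id y).mul_const (ψ t)).neg).exp
    refine (h.ofReal_comp.const_mul (w t)).congr_deriv ?_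
    push_cast
    ring

/-- The Macdonald-type integral `∫₀^∞ y ^ (a - 1) e ^ (-y - z / y) dy`. -/
noncomputable def macdonald (a : ℂ) (z : ℝ) : ℂ :=
  ∫ y in Set.Ioi (0 : ℝ), (y : ℂ) ^ (a - 1) * (Real.exp (-(y + z / y)) : ℂ)

lemma integrableOn_macdonald (a : ℂ) {z : ℝ} (hz : 0 < z) :
    IntegrableOn (fun y : ℝ => (y : ℂ) ^ (a - 1) * (Real.exp (-(y + z / y)) : ℂ))
      (Set.Ioi 0) := by
  simpa using integrableOn_cpow_mul_exp a one_pos hz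

lemma hasDerivAt_macdonald (a : ℂ) {z : ℝ} (hz : 0 < z) :
    HasDerivAt (macdonald a) (-macdonald (a - 1) z) z := by
  have e0 : ∀ x t : ℝ, (t : ℂ) ^ (a - 1) * (Real.exp (-(t + x / t)) : ℂ) =
      (t : ℂ) ^ (a - 1) * (Real.exp (-t) : ℂ) * (Real.exp (-(x * t⁻¹)) : ℂ) := by
    intro x t
    rw [neg_add, Real.exp_add, div_eq_mul_inv]
    push_cast
    ring
  have e1 : ∀ x t : ℝ, 0 < t → (t : ℂ) ^ (a - 1 - 1) * (Real.exp (-(t + x / t)) : ℂ) =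
      ((t⁻¹ : ℝ) : ℂ) * ((t : ℂ) ^ (a - 1) * (Real.exp (-t) : ℂ)) *
        (Real.exp (-(x * t⁻¹)) : ℂ) := by
    intro x t ht
    have ht' : (t : ℂ) ≠ 0 := by exact_mod_cast ht.ne'
    rw [neg_add, Real.exp_add, div_eq_mul_inv, Complex.cpow_sub (a - 1) 1 ht', Complex.cpow_one]
    push_cast
    field_simp
  have h := hasDerivAt_integral_exp_neg_mul
    (fun t : ℝ => (t : ℂ) ^ (a - 1) * (Real.exp (-t) : ℂ)) (fun t => t⁻¹)
    (fun t ht => (inv_pos.mpr ht).le) (fun x hx => ?_) (fun x hx => ?_) hz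
  · refine (h.congr_deriv ?_).congr_of_eventuallyEq ?_
    · rw [macdonald]
      congr 1
      exact setIntegral_congr_fun measurableSet_Ioi fun t ht => (e1 z t ht).symm
    · refine Filter.Eventually.of_forall fun x => ?_
      simp only [macdonald, e0]
  · simpa only [e0] using integrableOn_macdonald a hx
  · exact (integrableOn_macdonald (a - 1) hx).congr_fun (fun t ht => e1 x t ht) measurableSet_Ioi

lemma tendsto_cpow_mul_exp_nhds_zero (a : ℂ) {z : ℝ} (hz : 0 < z) :
    Filter.Tendsto (fun y : ℝ => (y : ℂ) ^ a * (Real.exp (-(y + z / y)) : ℂ))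
      (nhdsWithin 0 (Set.Ioi 0)) (nhds 0) := by
  obtain ⟨N, hN⟩ := exists_nat_gt (-a.re)
  have hlim : Filter.Tendsto (fun t : ℝ => N.factorial / z ^ N * t ^ (a.re + N))
      (nhdsWithin 0 (Set.Ioi 0)) (nhds 0) := by
    have : Filter.Tendsto (fun t : ℝ => t ^ (a.re + N)) (nhdsWithin 0 (Set.Ioi 0)) (nhds 0) := by
      have h := (Real.continuousAt_rpow_const 0 (a.re + N) (Or.inr (by linarith))).tendsto
      rw [Real.zero_rpow (by linarith)] at h
      exact h.mono_left nhdsWithin_le_nhds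
    simpa using this.const_mul (N.factorial / z ^ N : ℝ)
  refine squeeze_zero_norm' ?_ hlim
  filter_upwards [self_mem_nhdsWithin] with t ht
  have ht' : (0 : ℝ) < t := ht
  rw [norm_mul, Complex.norm_cpow_eq_rpow_re_of_pos ht', Complex.norm_real, Real.norm_eq_abs,
    Real.abs_exp, neg_add, Real.exp_add, Real.rpow_add ht', Real.rpow_natCast]
  have h1 := Real.pow_div_factorial_le_exp (z / t) (by positivity) N
  have h2 : Real.exp (-(z / t)) ≤ N.factorial / z ^ N * t ^ N := by
    rw [Real.exp_neg, inv_le_comm₀ (Real.exp_pos _) (by positivity)]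
    refine le_trans (le_of_eq ?_) h1
    rw [div_pow]
    field_simp
  have h3 : Real.exp (-t) ≤ 1 := Real.exp_le_one_iff.mpr (by linarith)
  calc t ^ a.re * (Real.exp (-t) * Real.exp (-(z / t)))
      ≤ t ^ a.re * (1 * (N.factorial / z ^ N * t ^ N)) := by gcongr
    _ = _ := by ring

lemma tendsto_cpow_mul_exp_atTop (a : ℂ) {z : ℝ} (hz : 0 < z) :
    Filter.Tendsto (fun y : ℝ => (y : ℂ) ^ a * (Real.exp (-(y + z / y)) : ℂ))
      Filter.atTop (nhds 0) := by
  refine squeeze_zero_norm' ?_ (tendsto_rpow_mul_exp_neg_mul_atTop_nhds_zero a.re 1 one_pos)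
  filter_upwards [Filter.eventually_gt_atTop 0] with t ht'
  rw [norm_mul, Complex.norm_cpow_eq_rpow_re_of_pos ht', Complex.norm_real, Real.norm_eq_abs,
    Real.abs_exp]
  gcongr
  have : 0 < z / t := by positivity
  linarith

lemma macdonald_add_one (a : ℂ) {z : ℝ} (hz : 0 < z) :
    macdonald (a + 1) z = a * macdonald a z + z * macdonald (a - 1) z := by
  have hd : ∀ y ∈ Set.Ioi (0 : ℝ),
      HasDerivAt (fun y : ℝ => (y : ℂ) ^ a * (Real.exp (-(y + z / y)) : ℂ))
      (a * ((y : ℂ) ^ (a - 1) * (Real.exp (-(y + z / y)) : ℂ)) +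
        z * ((y : ℂ) ^ (a - 1 - 1) * (Real.exp (-(y + z / y)) : ℂ)) -
        (y : ℂ) ^ (a + 1 - 1) * (Real.exp (-(y + z / y)) : ℂ)) y := by
    intro y hy
    have hy' : (0 : ℝ) < y := hy
    have hyc : (y : ℂ) ≠ 0 := by exact_mod_cast hy'.ne'
    have h1 : HasDerivAt (fun y : ℝ => (y : ℂ) ^ a) (a * (y : ℂ) ^ (a - 1)) y := by
      have := ((hasDerivAt_id (y : ℂ)).cpow_const (c := a) (Or.inl (by simpa using hy'))).comp_ofReal
      simpa using this
    have h2 : HasDerivAt (fun y : ℝ => Real.exp (-(y + z / y)))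
        (Real.exp (-(y + z / y)) * -(1 + z * (-(y ^ 2)⁻¹))) y := by
      have h3 : HasDerivAt (fun y : ℝ => z / y) (z * (-(y ^ 2)⁻¹)) y := by
        simpa only [div_eq_mul_inv] using (hasDerivAt_inv hy'.ne').const_mul z
      exact (((hasDerivAt_id y).add h3).neg).exp
    refine (h1.mul h2.ofReal_comp).congr_deriv ?_
    rw [Complex.cpow_sub (a - 1) 1 hyc, Complex.cpow_sub a 1 hyc, add_sub_cancel_right, Complex.cpow_one]
    push_cast
    field_simp
    ring
  have i1 := (integrableOn_macdonald a hz).const_mul a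
  have i2 := (integrableOn_macdonald (a - 1) hz).const_mul (z : ℂ)
  have i3 := integrableOn_macdonald (a + 1) hz
  set f : ℝ → ℂ := fun y => (y : ℂ) ^ a * (Real.exp (-(y + z / y)) : ℂ) with hf
  have h0 : ContinuousWithinAt (Function.update f 0 0) (Set.Ici 0) 0 := by
    rw [continuousWithinAt_update_same, Set.Ici_sdiff_left]
    exact tendsto_cpow_mul_exp_nhds_zero a hz
  have h := integral_Ioi_of_hasDerivAt_of_tendsto h0
    (fun y hy => (hd y hy).congr_of_eventuallyEq ?_) ((i1.add i2).sub i3)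
    ((tendsto_cpow_mul_exp_atTop a hz).congr' ?_)
  rotate_left
  · filter_upwards [isOpen_Ioi.mem_nhds hy] with x hx
    exact Function.update_of_ne (ne_of_gt hx) _ _
  · filter_upwards [Filter.eventually_gt_atTop 0] with x hx
    exact (Function.update_of_ne hx.ne' (0 : ℂ) f).symm
  rw [Function.update_self, sub_zero] at h
  have h' := integral_sub (i1.add i2) i3
  simp only [Pi.add_apply] at h'
  rw [h', integral_add i1 i2, integral_const_mul, integral_const_mul] at h
  simp only [macdonald]
  linear_combination -h

lemma tendsto_macdonald_nhds_zero {a : ℂ} (ha : 0 < a.re) :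
    Filter.Tendsto (macdonald a) (nhdsWithin 0 (Set.Ioi 0)) (nhds (Complex.Gamma a)) := by
  rw [Complex.Gamma_eq_integral ha, Complex.GammaIntegral]
  refine tendsto_integral_filter_of_dominated_convergence
    (fun y => Real.exp (-y) * y ^ (a.re - 1)) ?_ ?_ (Real.GammaIntegral_convergent ha) ?_
  · filter_upwards [self_mem_nhdsWithin] with z hz
    exact (integrableOn_macdonald a hz).aestronglyMeasurable
  · filter_upwards [self_mem_nhdsWithin] with z hz
    have hz' : (0 : ℝ) < z := hz
    filter_upwards [ae_restrict_mem measurableSet_Ioi] with t ht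
    have ht' : (0 : ℝ) < t := ht
    rw [norm_mul, Complex.norm_cpow_eq_rpow_re_of_pos ht', Complex.norm_real, Real.norm_eq_abs,
      Real.abs_exp, mul_comm, Complex.sub_re, Complex.one_re]
    gcongr
    have : 0 < z / t := by positivity
    linarith
  · filter_upwards with t
    have : Continuous fun z : ℝ => (t : ℂ) ^ (a - 1) * (Real.exp (-(t + z / t)) : ℂ) := by
      have h : Continuous fun z : ℝ => Real.exp (-(t + z / t)) := by
        simp only [div_eq_mul_inv]; fun_prop
      exact continuous_const.mul (Complex.continuous_ofReal.comp h)
    have h := (this.tendsto 0).mono_left (nhdsWithin_le_nhds (s := Set.Ioi 0))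
    simpa [mul_comm] using h

lemma macdonald_mul_besselEntire_add {ν : ℂ} (hν : -1 < ν.re) {z : ℝ} (hz : 0 < z) :
    macdonald (ν + 1) z * besselEntire ν z + z * macdonald ν z * besselEntire (ν + 1) z = 1 := by
  set W : ℝ → ℂ := fun z => macdonald (ν + 1) z * besselEntire ν z +
    z * macdonald ν z * besselEntire (ν + 1) z with hW
  have hd : ∀ z ∈ Set.Ioi (0 : ℝ), HasDerivAt W 0 z := by
    intro z hz
    have hz' : (0 : ℝ) < z := hz
    have h1 := hasDerivAt_macdonald (ν + 1) hz'
    have h2 := hasDerivAt_macdonald ν hz'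
    have h3 := (hasDerivAt_besselEntire ν (z : ℂ)).comp_ofReal
    have h4 := (hasDerivAt_besselEntire (ν + 1) (z : ℂ)).comp_ofReal
    have h0 : HasDerivAt (fun z : ℝ => (z : ℂ)) 1 z := (hasDerivAt_id (z : ℂ)).comp_ofReal
    refine ((h1.mul h3).add ((h0.mul h2).mul h4)).congr_deriv ?_
    have e1 := macdonald_add_one ν hz'
    have e2 := besselEntire_eq ν (z : ℂ)
    rw [add_sub_cancel_right, show ν + 1 + 1 = ν + 2 by ring]
    simp only [Pi.mul_apply]
    linear_combination besselEntire (ν + 1) z * e1 - macdonald ν z * e2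
  obtain ⟨c, hc⟩ := isOpen_Ioi.exists_is_const_of_deriv_eq_zero isPreconnected_Ioi
    (fun z hz => (hd z hz).differentiableAt.differentiableWithinAt)
    (fun z hz => (hd z hz).deriv)
  have hlim : Filter.Tendsto W (nhdsWithin 0 (Set.Ioi 0)) (nhds 1) := by
    have hre : 0 < (ν + 1).re := by simp; linarith
    have h1 := tendsto_macdonald_nhds_zero hre
    have h2 := tendsto_macdonald_nhds_zero (a := ν + 1 + 1) (by simp; linarith)
    have h3 : ∀ μ, Filter.Tendsto (fun z : ℝ => besselEntire μ z)
        (nhdsWithin 0 (Set.Ioi 0)) (nhds (Complex.Gamma (μ + 1))⁻¹) := by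
      intro μ
      have := ((continuous_besselEntire μ).comp Complex.continuous_ofReal).tendsto 0
      simp only [Function.comp_apply, Complex.ofReal_zero, besselEntire_zero] at this
      exact this.mono_left nhdsWithin_le_nhds
    have h4 : Filter.Tendsto (fun z : ℝ => z * macdonald ν z)
        (nhdsWithin 0 (Set.Ioi 0)) (nhds 0) := by
      have h5 := h2.sub (h1.const_mul (ν + 1))
      rw [Complex.Gamma_add_one (ν + 1) (fun h => by simp [h] at hre), sub_self] at h5
      refine h5.congr' ?_
      filter_upwards [self_mem_nhdsWithin] with z hz
      rw [macdonald_add_one (ν + 1) hz, add_sub_cancel_right]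
      ring
    have h6 := (h1.mul (h3 ν)).add (h4.mul (h3 (ν + 1)))
    rwa [mul_inv_cancel₀ (Complex.Gamma_ne_zero_of_re_pos hre), zero_mul, add_zero] at h6
  have hc1 : c = 1 := by
    refine tendsto_nhds_unique (tendsto_const_nhds.congr' ?_) hlim
    filter_upwards [self_mem_nhdsWithin] with z hz
    exact (hc z hz).symm
  exact (hc z hz).trans hc1

lemma ofReal_mul_cpow_sub_one (a : ℂ) {x : ℝ} (hx : 0 < x) :
    (x : ℂ) * (x : ℂ) ^ (a - 1) = (x : ℂ) ^ a := by
  have hx' : (x : ℂ) ≠ 0 := by exact_mod_cast hx.ne'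
  rw [Complex.cpow_sub _ _ hx', Complex.cpow_one]
  field_simp

lemma macdonald_eq_scale (a : ℂ) (z : ℝ) {c : ℝ} (hc : 0 < c) :
    macdonald a z = (c : ℂ) ^ a * ∫ t in Set.Ioi (0 : ℝ),
      (t : ℂ) ^ (a - 1) * (Real.exp (-(c * t + z / (c * t))) : ℂ) := by
  have h := integral_comp_mul_left_Ioi
    (fun y : ℝ => (y : ℂ) ^ (a - 1) * (Real.exp (-(y + z / y)) : ℂ)) 0 hc
  rw [mul_zero] at h
  have hc' : (c : ℂ) ≠ 0 := by exact_mod_cast hc.ne'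
  have h1 : ∫ t in Set.Ioi (0 : ℝ),
      ((c * t : ℝ) : ℂ) ^ (a - 1) * (Real.exp (-(c * t + z / (c * t))) : ℂ) =
      (c : ℂ) ^ (a - 1) * ∫ t in Set.Ioi (0 : ℝ),
      (t : ℂ) ^ (a - 1) * (Real.exp (-(c * t + z / (c * t))) : ℂ) := by
    rw [← integral_const_mul]
    refine setIntegral_congr_fun measurableSet_Ioi fun t ht => ?_
    have ht' : (0 : ℝ) < t := ht
    rw [Complex.ofReal_mul, Complex.mul_cpow_ofReal_nonneg hc.le ht'.le]
    ring
  rw [h1, Complex.real_smul, Complex.ofReal_inv] at h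
  rw [macdonald, ← ofReal_mul_cpow_sub_one a hc, mul_assoc, h]
  field_simp

lemma macdonald_neg (a : ℂ) {z : ℝ} (hz : 0 < z) :
    macdonald (-a) z = (z : ℂ) ^ (-a) * macdonald a z := by
  have h := integral_comp_rpow_Ioi
    (fun y : ℝ => (y : ℂ) ^ (-a - 1) * (Real.exp (-(y + z / y)) : ℂ)) (p := -1) (by norm_num)
  have hz' : (z : ℂ) ≠ 0 := by exact_mod_cast hz.ne'
  rw [macdonald_eq_scale a z hz, ← mul_assoc, ← Complex.cpow_add _ _ hz', neg_add_cancel,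
    Complex.cpow_zero, one_mul, macdonald, ← h]
  refine setIntegral_congr_fun measurableSet_Ioi fun t ht => ?_
  have ht' : (0 : ℝ) < t := ht
  have htc : (t : ℂ) ≠ 0 := by exact_mod_cast ht'.ne'
  have e1 : ((t⁻¹ : ℝ) : ℂ) ^ (-a - 1) = (t : ℂ) ^ (a + 1) := by
    rw [Complex.ofReal_inv, Complex.inv_cpow _ _ (by
      rw [Complex.arg_ofReal_of_nonneg ht'.le]; exact Real.pi_pos.ne), ← Complex.cpow_neg]
    congr 1; ring
  have e2 : (t : ℝ) ^ (-1 - 1 : ℝ) = (t ^ 2)⁻¹ := by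
    rw [show (-1 - 1 : ℝ) = -((2 : ℕ) : ℝ) by norm_num, Real.rpow_neg ht'.le, Real.rpow_natCast]
  have e3 : -(t⁻¹ + z / t⁻¹) = -(z * t + z / (z * t)) := by
    field_simp; ring
  simp only [Real.rpow_neg_one, e2, abs_neg, abs_one, one_mul, e3, e1, Complex.real_smul]
  rw [Complex.cpow_add _ _ htc, Complex.cpow_sub _ _ htc, Complex.cpow_one]
  push_cast
  field_simp

lemma macdonald_mul_sin {ν : ℂ} (hν : |ν.re| < 1) (hν0 : ν ≠ 0) {z : ℝ} (hz : 0 < z) :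
    macdonald ν z * (Complex.sin (Real.pi * ν) / Real.pi) =
      besselEntire (-ν) z - (z : ℂ) ^ ν * besselEntire ν z := by
  have hre := abs_lt.mp hν
  have h1 := macdonald_mul_besselEntire_add (ν := ν) hre.1 hz
  have h2 := macdonald_mul_besselEntire_add (ν := -ν) (by simp; linarith) hz
  have h3 := macdonald_neg ν hz
  have h4 := macdonald_neg (ν - 1) hz
  have h5 := macdonald_add_one ν hz
  have hz' : (z : ℂ) ≠ 0 := by exact_mod_cast hz.ne'
  rw [← besselEntire_wronskian ν hν hν0 z]
  rw [show -ν + 1 = -(ν - 1) by ring, h4, h3, show -(ν - 1) = 1 - ν by ring,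
    Complex.cpow_sub _ _ hz', Complex.cpow_one, Complex.cpow_neg] at h2
  rw [show -ν + 1 = 1 - ν by ring]
  have hp : (z : ℂ) ^ ν ≠ 0 := by simp [Complex.cpow_eq_zero_iff, hz']
  field_simp at h2
  linear_combination besselEntire (-ν) z * h1 - besselEntire ν z * h2 -
    besselEntire ν z * besselEntire (-ν) z * h5

/-- Twice the Macdonald function: `besselKInt a x = 2 K_a(2πx)`. -/
noncomputable def besselKInt (a : ℂ) (x : ℝ) : ℂ :=
  ∫ t in Set.Ioi (0 : ℝ), (t : ℂ) ^ (a - 1) * (Real.exp (-(Real.pi * x * (t + 1 / t))) : ℂ)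

lemma macdonald_sq_eq (a : ℂ) {x : ℝ} (hx : 0 < x) :
    macdonald a ((Real.pi * x) ^ 2) = ((Real.pi * x : ℝ) : ℂ) ^ a * besselKInt a x := by
  have hc : 0 < Real.pi * x := mul_pos Real.pi_pos hx
  rw [macdonald_eq_scale a _ hc, besselKInt]
  congr 1
  refine setIntegral_congr_fun measurableSet_Ioi fun t ht => ?_
  have ht' : t ≠ 0 := ne_of_gt ht
  congr 4
  field_simp

lemma sq_cpow {c : ℝ} (hc : 0 < c) (a : ℂ) :
    ((c ^ 2 : ℝ) : ℂ) ^ a = (c : ℂ) ^ a * (c : ℂ) ^ a := by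
  rw [sq, Complex.ofReal_mul, Complex.mul_cpow_ofReal_nonneg hc.le hc.le]

lemma ofReal_cpow_ne_zero {c : ℝ} (hc : 0 < c) (a : ℂ) : (c : ℂ) ^ a ≠ 0 := by
  have hc' : (c : ℂ) ≠ 0 := by exact_mod_cast hc.ne'
  simp [Complex.cpow_eq_zero_iff, hc']

lemma besselKInt_neg (a : ℂ) {x : ℝ} (hx : 0 < x) : besselKInt (-a) x = besselKInt a x := by
  have hc : 0 < Real.pi * x := mul_pos Real.pi_pos hx
  have h := macdonald_neg a (pow_pos hc 2)
  rw [macdonald_sq_eq _ hx, macdonald_sq_eq _ hx, sq_cpow hc, Complex.cpow_neg] at h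
  have := ofReal_cpow_ne_zero hc a
  field_simp at h
  exact h

lemma besselKInt_mul_sin {ν : ℂ} (hν : |ν.re| < 1) (hν0 : ν ≠ 0) {x : ℝ} (hx : 0 < x) :
    besselKInt ν x * (Complex.sin (Real.pi * ν) / Real.pi) =
      ((Real.pi * x : ℝ) : ℂ) ^ (-ν) * besselEntire (-ν) ((Real.pi * x) ^ 2) -
      ((Real.pi * x : ℝ) : ℂ) ^ ν * besselEntire ν ((Real.pi * x) ^ 2) := by
  have hc : 0 < Real.pi * x := mul_pos Real.pi_pos hx
  have h := macdonald_mul_sin hν hν0 (pow_pos hc 2)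
  have hp := ofReal_cpow_ne_zero hc ν
  rw [macdonald_sq_eq _ hx, sq_cpow hc, Complex.ofReal_pow, Complex.ofReal_mul] at h
  rw [Complex.ofReal_mul] at hp ⊢
  rw [Complex.cpow_neg, ← sub_eq_zero]
  rw [← sub_eq_zero] at h
  rw [← mul_right_inj' hp, mul_zero, ← h]
  field_simp

lemma besselKInt_add_one_sub (a : ℂ) {x : ℝ} (hx : 0 < x) :
    a * besselKInt a x = Real.pi * x * (besselKInt (a + 1) x - besselKInt (a - 1) x) := by
  have hc : 0 < Real.pi * x := mul_pos Real.pi_pos hx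
  have h := macdonald_add_one a (pow_pos hc 2)
  have hc' : ((Real.pi * x : ℝ) : ℂ) ≠ 0 := by exact_mod_cast hc.ne'
  have hp := ofReal_cpow_ne_zero hc a
  rw [macdonald_sq_eq _ hx, macdonald_sq_eq _ hx, macdonald_sq_eq _ hx, Complex.cpow_add _ _ hc',
    Complex.cpow_sub _ _ hc', Complex.cpow_one] at h
  rw [← mul_right_inj' hp]
  push_cast at h hc' ⊢
  field_simp at h
  linear_combination -h

lemma integrableOn_besselKInt (a : ℂ) {x : ℝ} (hx : 0 < x) :
    IntegrableOn (fun t : ℝ => (t : ℂ) ^ (a - 1) *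
      (Real.exp (-(Real.pi * x * (t + 1 / t))) : ℂ)) (Set.Ioi 0) := by
  have hc : 0 < Real.pi * x := mul_pos Real.pi_pos hx
  have h := integrableOn_cpow_mul_exp a hc hc
  simpa only [mul_add, mul_one_div] using h

/-- The integrals `∫₀^∞ t ^ (ν - 1) (t + 1/t + 2s) ^ j e ^ (-πx(t + 1/t)) dt` entering the
Kirillov vectors, with `s` the sign. -/
noncomputable def kirillovInt (ν : ℂ) (s : ℝ) (j : ℕ) (x : ℝ) : ℂ :=
  ∫ t in Set.Ioi (0 : ℝ), (t : ℂ) ^ (ν - 1) * (((t + 1 / t + 2 * s) ^ j : ℝ) : ℂ) *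
    (Real.exp (-(Real.pi * x * (t + 1 / t))) : ℂ)

lemma integrableOn_kirillovInt (ν : ℂ) (s : ℝ) (j : ℕ) {x : ℝ} (hx : 0 < x) :
    IntegrableOn (fun t : ℝ => (t : ℂ) ^ (ν - 1) * (((t + 1 / t + 2 * s) ^ j : ℝ) : ℂ) *
      (Real.exp (-(Real.pi * x * (t + 1 / t))) : ℂ)) (Set.Ioi 0) := by
  induction j generalizing ν with
  | zero => simpa using integrableOn_besselKInt ν hx
  | succ j ih =>
    refine (((ih (ν + 1)).add (ih (ν - 1))).add ((ih ν).const_mul (2 * s : ℂ))).congr_fun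
      (fun t ht => ?_) measurableSet_Ioi
    have ht' : (0 : ℝ) < t := ht
    have htc : (t : ℂ) ≠ 0 := by exact_mod_cast ht'.ne'
    simp only [Pi.add_apply]
    rw [pow_succ, show ν + 1 - 1 = ν - 1 + 1 by ring, Complex.cpow_add _ _ htc,
      Complex.cpow_sub (ν - 1) 1 htc, Complex.cpow_one]
    push_cast
    field_simp

lemma hasDerivAt_kirillovInt (ν : ℂ) (s : ℝ) (j : ℕ) {x : ℝ} (hx : 0 < x) :
    HasDerivAt (kirillovInt ν s j)
      (-Real.pi * (kirillovInt ν s (j + 1) x - 2 * s * kirillovInt ν s j x)) x := by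
  have e0 : ∀ x t : ℝ, (t : ℂ) ^ (ν - 1) * (((t + 1 / t + 2 * s) ^ j : ℝ) : ℂ) *
      (Real.exp (-(Real.pi * x * (t + 1 / t))) : ℂ) =
      ((t : ℂ) ^ (ν - 1) * (((t + 1 / t + 2 * s) ^ j : ℝ) : ℂ)) *
      (Real.exp (-(x * (Real.pi * (t + 1 / t)))) : ℂ) := by
    intro x t
    rw [show Real.pi * x * (t + 1 / t) = x * (Real.pi * (t + 1 / t)) by ring]
  have e1 : ∀ x t : ℝ, (Real.pi : ℂ) * ((t : ℂ) ^ (ν - 1) *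
      (((t + 1 / t + 2 * s) ^ (j + 1) : ℝ) : ℂ) *
      (Real.exp (-(Real.pi * x * (t + 1 / t))) : ℂ)) -
      (Real.pi * (2 * s)) * ((t : ℂ) ^ (ν - 1) * (((t + 1 / t + 2 * s) ^ j : ℝ) : ℂ) *
      (Real.exp (-(Real.pi * x * (t + 1 / t))) : ℂ)) =
      ((Real.pi * (t + 1 / t) : ℝ) : ℂ) * ((t : ℂ) ^ (ν - 1) *
      (((t + 1 / t + 2 * s) ^ j : ℝ) : ℂ)) *
      (Real.exp (-(x * (Real.pi * (t + 1 / t)))) : ℂ) := by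
    intro x t
    rw [show Real.pi * x * (t + 1 / t) = x * (Real.pi * (t + 1 / t)) by ring, pow_succ]
    push_cast
    ring
  have i1 := fun (x : ℝ) (hx : 0 < x) =>
    (integrableOn_kirillovInt ν s (j + 1) hx).const_mul (Real.pi : ℂ)
  have i2 := fun (x : ℝ) (hx : 0 < x) =>
    (integrableOn_kirillovInt ν s j hx).const_mul (Real.pi * (2 * s) : ℂ)
  have h := hasDerivAt_integral_exp_neg_mul
    (fun t : ℝ => (t : ℂ) ^ (ν - 1) * (((t + 1 / t + 2 * s) ^ j : ℝ) : ℂ))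
    (fun t => Real.pi * (t + 1 / t)) (fun t ht => by positivity) (fun x hx => ?_)
    (fun x hx => ?_) hx
  · simp only [← e0, ← e1] at h
    refine h.congr_deriv ?_
    have h' := integral_sub (i1 x hx) (i2 x hx)
    rw [h', integral_const_mul, integral_const_mul]
    simp only [kirillovInt]
    ring
  · simpa only [e0] using integrableOn_kirillovInt ν s j hx
  · simp only [← e1]
    exact (i1 x hx).sub (i2 x hx)

lemma kirillovInt_zero (ν : ℂ) (s x : ℝ) : kirillovInt ν s 0 x = besselKInt ν x := by
  simp [kirillovInt, besselKInt]

lemma kirillovInt_one (ν : ℂ) {x : ℝ} (hx : 0 < x) :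
    kirillovInt ν 0 1 x = besselKInt (ν + 1) x + besselKInt (ν - 1) x := by
  simp only [kirillovInt, besselKInt]
  have h' := integral_add (integrableOn_besselKInt (ν + 1) hx) (integrableOn_besselKInt (ν - 1) hx)
  rw [← h']
  refine setIntegral_congr_fun measurableSet_Ioi fun t ht => ?_
  have ht' : (0 : ℝ) < t := ht
  have htc : (t : ℂ) ≠ 0 := by exact_mod_cast ht'.ne'
  rw [show ν + 1 - 1 = ν - 1 + 1 by ring, Complex.cpow_add _ _ htc,
      Complex.cpow_sub (ν - 1) 1 htc, Complex.cpow_one]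
  push_cast
  field_simp
  ring

lemma hasDerivAt_besselKInt (ν : ℂ) {x : ℝ} (hx : 0 < x) :
    HasDerivAt (besselKInt ν) (-Real.pi * (besselKInt (ν + 1) x + besselKInt (ν - 1) x)) x := by
  have h := hasDerivAt_kirillovInt ν 0 0 hx
  rw [show kirillovInt ν 0 0 = besselKInt ν from funext fun y => kirillovInt_zero ν 0 y] at h
  simpa [kirillovInt_one ν hx] using h

lemma exists_norm_besselKInt_le {a : ℂ} {β : ℝ} (hβ : 0 < β) (ha : |a.re| ≤ β) :
    ∃ C : ℝ, 0 ≤ C ∧ ∀ x : ℝ, 0 < x →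
      ‖besselKInt a x‖ ≤ C * (x ^ (-β) * Real.exp (-(Real.pi * x))) := by
  refine ⟨2 * ((2 / Real.pi) ^ β * Real.Gamma β),
    by have := Real.Gamma_pos_of_pos hβ; positivity, fun x hx => ?_⟩
  have hnorm : ∀ (b : ℂ) (t : ℝ), 0 < t →
      ‖(t : ℂ) ^ (b - 1) * (Real.exp (-(Real.pi * x * (t + 1 / t))) : ℂ)‖ =
        t ^ (b.re - 1) * Real.exp (-(Real.pi * x * (t + 1 / t))) := by
    intro b t ht
    rw [norm_mul, Complex.norm_cpow_eq_rpow_re_of_pos ht, Complex.norm_real, Real.norm_eq_abs,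
      Real.abs_exp, Complex.sub_re, Complex.one_re]
  have hint : ∀ b : ℝ, IntegrableOn (fun t : ℝ =>
      t ^ (b - 1) * Real.exp (-(Real.pi * x * (t + 1 / t)))) (Set.Ioi 0) := by
    intro b
    have h : IntegrableOn (fun t : ℝ => ‖(t : ℂ) ^ ((b : ℂ) - 1) *
      (Real.exp (-(Real.pi * x * (t + 1 / t))) : ℂ)‖) (Set.Ioi 0) :=
      (integrableOn_besselKInt (b : ℂ) hx).norm
    exact h.congr_fun (fun t ht => hnorm (b : ℂ) t ht) measurableSet_Ioi
  have hcoe : ∀ b : ℝ, ((∫ t in Set.Ioi (0 : ℝ),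
      t ^ (b - 1) * Real.exp (-(Real.pi * x * (t + 1 / t))) : ℝ) : ℂ) = besselKInt b x := by
    intro b
    rw [← integral_complex_ofReal, besselKInt]
    refine setIntegral_congr_fun measurableSet_Ioi fun t ht => ?_
    have ht' : (0 : ℝ) < t := ht
    simp [Complex.ofReal_cpow ht'.le]
  have hsymm : (∫ t in Set.Ioi (0 : ℝ),
      t ^ (-β - 1) * Real.exp (-(Real.pi * x * (t + 1 / t)))) = ∫ t in Set.Ioi (0 : ℝ),
      t ^ (β - 1) * Real.exp (-(Real.pi * x * (t + 1 / t))) := by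
    apply Complex.ofReal_injective
    rw [hcoe, hcoe, Complex.ofReal_neg, besselKInt_neg _ hx]
  have hle1 : ‖besselKInt a x‖ ≤ 2 * ∫ t in Set.Ioi (0 : ℝ),
      t ^ (β - 1) * Real.exp (-(Real.pi * x * (t + 1 / t))) := by
    rw [two_mul]
    nth_rewrite 2 [← hsymm]
    rw [← integral_add (hint β) (hint (-β))]
    refine norm_integral_le_of_norm_le ((hint β).add (hint (-β))) ?_
    filter_upwards [ae_restrict_mem measurableSet_Ioi] with t ht
    have ht' : (0 : ℝ) < t := ht
    rw [hnorm a t ht', ← add_mul]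
    have hb := abs_le.mp ha
    gcongr
    rcases le_total 1 t with h | h
    · exact (Real.rpow_le_rpow_of_exponent_le h (by linarith)).trans
        (le_add_of_nonneg_right (by positivity))
    · exact (Real.rpow_le_rpow_of_exponent_ge ht' h (by linarith)).trans
        (le_add_of_nonneg_left (by positivity))
  have hle2 : (∫ t in Set.Ioi (0 : ℝ), t ^ (β - 1) * Real.exp (-(Real.pi * x * (t + 1 / t)))) ≤
      ∫ t in Set.Ioi (0 : ℝ),
        Real.exp (-(Real.pi * x)) * (t ^ (β - 1) * Real.exp (-(Real.pi * x / 2 * t))) := by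
    refine setIntegral_mono_on (hint β) ?_ measurableSet_Ioi fun t ht => ?_
    · refine Integrable.const_mul ?_ _
      change IntegrableOn (fun t : ℝ => t ^ (β - 1) * Real.exp (-(Real.pi * x / 2 * t)))
        (Set.Ioi 0) volume
      have := integrableOn_rpow_mul_exp_neg_mul_rpow (s := β - 1) (p := 1)
        (b := Real.pi * x / 2) (by linarith) one_pos (by positivity)
      simpa only [Real.rpow_one, neg_mul] using this
    · have ht' : (0 : ℝ) < t := ht
      rw [mul_left_comm, ← Real.exp_add]
      gcongr
      have h1 : 2 ≤ t + 1 / t := by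
        have : t + 1 / t - 2 = (t - 1) ^ 2 / t := by field_simp; ring
        have h2 : 0 ≤ (t - 1) ^ 2 / t := by positivity
        linarith
      have h2 : 0 < 1 / t := by positivity
      have h3 : 1 + t / 2 ≤ t + 1 / t := by linarith
      have h4 : 0 < Real.pi * x := by positivity
      nlinarith
  rw [integral_const_mul, Real.integral_rpow_mul_exp_neg_mul_Ioi hβ (by positivity)] at hle2
  refine (hle1.trans (mul_le_mul_of_nonneg_left hle2 zero_le_two)).trans (le_of_eq ?_)
  rw [show 1 / (Real.pi * x / 2) = 2 / Real.pi * x⁻¹ by field_simp,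
    Real.mul_rpow (by positivity) (by positivity), Real.inv_rpow hx.le, Real.rpow_neg hx.le]
  ring

/-- The coefficients of the Kirillov vector. -/
noncomputable def kirillovCoeff (L j : ℕ) : ℂ :=
  (-(Real.pi : ℂ)) ^ j * ((2 * L).choose (2 * j) : ℂ) * Complex.Gamma ((L : ℂ) - j + 1 / 2)

lemma choose_two_step (n k : ℕ) :
    ((n : ℂ) - k - 1) * ((n + 2).choose (k + 2) : ℂ) =
      (n + k + 3) * (n.choose (k + 2) : ℂ) + (n - k - 1) * (n.choose k : ℂ) := by
  have h1 : ((n.choose (k + 2) : ℕ) : ℂ) * (k + 2) = n.choose (k + 1) * (n - k - 1) := by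
    rcases lt_or_ge n (k + 1) with h | h
    · rw [Nat.choose_eq_zero_of_lt h, Nat.choose_eq_zero_of_lt (by omega)]; simp
    · have := Nat.choose_succ_right_eq n (k + 1)
      have h2 : ((n - (k + 1) : ℕ) : ℂ) = n - k - 1 := by rw [Nat.cast_sub h]; push_cast; ring
      rw [← h2]
      exact_mod_cast this
  have h2 : (n + 2).choose (k + 2) = n.choose k + 2 * n.choose (k + 1) + n.choose (k + 2) := by
    rw [Nat.choose_succ_succ, Nat.choose_succ_succ n k, Nat.choose_succ_succ n (k + 1)]; ring
  rw [h2]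
  push_cast
  linear_combination -2 * h1

lemma kirillovCoeff_succ_zero (L : ℕ) :
    kirillovCoeff (L + 1) 0 = (L + 1 / 2) * kirillovCoeff L 0 := by
  have h : ((L : ℂ) + 1 / 2) ≠ 0 := by
    intro h
    have := congrArg Complex.re h
    simp at this
    have h0 : (0 : ℝ) ≤ L := L.cast_nonneg
    norm_num at this
    linarith
  simp only [kirillovCoeff, pow_zero, one_mul, mul_zero, Nat.choose_zero_right, Nat.cast_one,
    Nat.cast_zero, sub_zero]
  rw [← Complex.Gamma_add_one _ h]
  push_cast
  ring_nf

lemma kirillovCoeff_succ_succ (L j : ℕ) :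
    kirillovCoeff (L + 1) (j + 1) =
      (L + 1 / 2 + (j + 1 : ℕ)) * kirillovCoeff L (j + 1) - Real.pi * kirillovCoeff L j := by
  have h : ((L : ℂ) - j - 1 / 2) ≠ 0 := by
    intro h
    have h2 : (((2 * (L - j) - 1 : ℤ) : ℂ)) = 0 := by push_cast; linear_combination 2 * h
    have h3 : (2 * ((L : ℤ) - j) - 1 : ℤ) = 0 := by exact_mod_cast h2
    omega
  have hG := Complex.Gamma_add_one _ h
  have hc := choose_two_step (2 * L) (2 * j)
  simp only [kirillovCoeff]
  rw [show 2 * (L + 1) = 2 * L + 2 by ring, show 2 * (j + 1) = 2 * j + 2 by ring]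
  rw [show (((L + 1 : ℕ) : ℂ) - ((j + 1 : ℕ) : ℂ) + 1 / 2) = L - j - 1 / 2 + 1 by push_cast; ring,
    show ((L : ℂ) - ((j + 1 : ℕ) : ℂ) + 1 / 2) = L - j - 1 / 2 by push_cast; ring,
    show ((L : ℂ) - (j : ℂ) + 1 / 2) = L - j - 1 / 2 + 1 by ring, hG, pow_succ]
  push_cast at hc ⊢
  linear_combination (-(Real.pi : ℂ)) ^ j * (-Real.pi) * Complex.Gamma (L - j - 1 / 2) / 2 * hc

lemma kirillovCoeff_self_succ (L : ℕ) : kirillovCoeff L (L + 1) = 0 := by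
  simp [kirillovCoeff, Nat.choose_eq_zero_of_lt (show 2 * L < 2 * (L + 1) by omega)]

/-- The Kirillov vector of weight `L ≥ 0`, up to its normalising constant. -/
noncomputable def kirillovSum (ν : ℂ) (L : ℕ) (u : ℝ) : ℂ :=
  (Real.sqrt |u| : ℂ) * ∑ j ∈ Finset.range (L + 1),
    kirillovCoeff L j * (((|u| : ℝ) : ℂ) ^ j * kirillovInt ν (Real.sign u) j |u|)

lemma sum_kirillovCoeff_succ (L : ℕ) (y : ℕ → ℂ) :
    ∑ j ∈ Finset.range (L + 2), kirillovCoeff (L + 1) j * y j =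
      ∑ j ∈ Finset.range (L + 1),
        kirillovCoeff L j * ((L + 1 / 2 + j) * y j - Real.pi * y (j + 1)) := by
  have h1 : ∑ j ∈ Finset.range (L + 1), kirillovCoeff L j * ((L + 1 / 2 + j) * y j) =
      ∑ j ∈ Finset.range (L + 2), kirillovCoeff L j * ((L + 1 / 2 + j) * y j) := by
    rw [Finset.sum_range_succ _ (L + 1), kirillovCoeff_self_succ, zero_mul, add_zero]
  simp only [mul_sub, Finset.sum_sub_distrib]
  rw [h1, Finset.sum_range_succ', Finset.sum_range_succ' _ (L + 1), kirillovCoeff_succ_zero]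
  simp only [kirillovCoeff_succ_succ, sub_mul, Finset.sum_sub_distrib]
  simp only [Nat.cast_zero, add_zero, mul_assoc, mul_left_comm, mul_comm]
  ring

lemma hasDerivAt_kirillovSum (ν : ℂ) (L : ℕ) {u : ℝ} (hu : u ≠ 0) :
    HasDerivAt (kirillovSum ν L)
      ((kirillovSum ν (L + 1) u + (2 * Real.pi * u - L) * kirillovSum ν L u) / u) u := by
  set s := Real.sign u with hs
  have habs : ∀ᶠ v in nhds u, Real.sign v = s ∧ |v| = s * v := by
    rcases lt_or_gt_of_ne hu with h | h
    · filter_upwards [Iio_mem_nhds h] with v hv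
      have hv' : v < 0 := hv
      simp [hs, Real.sign_of_neg h, Real.sign_of_neg hv', abs_of_neg hv']
    · filter_upwards [Ioi_mem_nhds h] with v hv
      have hv' : 0 < v := hv
      simp [hs, Real.sign_of_pos h, Real.sign_of_pos hv', abs_of_pos hv']
  have hx : 0 < |u| := abs_pos.mpr hu
  have hss : s * |u| = u := by
    rcases lt_or_gt_of_ne hu with h | h
    · simp [hs, Real.sign_of_neg h, abs_of_neg h]
    · simp [hs, Real.sign_of_pos h, abs_of_pos h]
  have hsu := habs.self_of_nhds.2
  set F : ℝ → ℂ := fun x => (Real.sqrt x : ℂ) * ∑ j ∈ Finset.range (L + 1),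
    kirillovCoeff L j * ((x : ℂ) ^ j * kirillovInt ν s j x) with hF
  have hsqrt : HasDerivAt (fun x : ℝ => ((Real.sqrt x : ℝ) : ℂ))
      ((1 / (2 * Real.sqrt |u|) : ℝ) : ℂ) |u| := (Real.hasDerivAt_sqrt hx.ne').ofReal_comp
  have hpow : ∀ j : ℕ, HasDerivAt (fun x : ℝ => (x : ℂ) ^ j)
      (j * ((|u| : ℝ) : ℂ) ^ (j - 1)) |u| := fun j => (hasDerivAt_pow j _).comp_ofReal
  have hsum := HasDerivAt.fun_sum (u := Finset.range (L + 1)) fun j _ =>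
    ((hpow j).mul (hasDerivAt_kirillovInt ν s j hx)).const_mul (kirillovCoeff L j)
  have hd := hsqrt.mul hsum
  have hlin : HasDerivAt (fun v : ℝ => s * v) s u := by
    simpa using (hasDerivAt_id u).const_mul s
  have hd' := hd
  rw [hsu] at hd'
  have hcomp := hd'.scomp u hlin
  have heq : kirillovSum ν L =ᶠ[nhds u] fun v => F (s * v) := by
    filter_upwards [habs] with v hv
    simp only [kirillovSum, hF, hv.1, hv.2]
  refine (hcomp.congr_of_eventuallyEq heq).congr_deriv ?_
  rw [← hsu]
  have hxc : ((|u| : ℝ) : ℂ) ≠ 0 := by exact_mod_cast hx.ne'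
  have huc : (u : ℂ) ≠ 0 := by exact_mod_cast hu
  have hS : ((1 / (2 * Real.sqrt |u|) : ℝ) : ℂ) * ((|u| : ℝ) : ℂ) = (Real.sqrt |u| : ℂ) / 2 := by
    rw [← Complex.ofReal_mul]
    have : (1 / (2 * Real.sqrt |u|)) * |u| = Real.sqrt |u| / 2 := by
      nth_rewrite 2 [← Real.mul_self_sqrt hx.le]
      have := (Real.sqrt_pos.mpr hx).ne'
      field_simp
    rw [this]; push_cast; rfl
  rw [Complex.real_smul, eq_div_iff huc, mul_comm (s : ℂ), mul_assoc]
  have hsu2 : (s : ℂ) * u = ((|u| : ℝ) : ℂ) := by rw [hsu]; push_cast; rfl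
  have hss2 : (s : ℂ) * ((|u| : ℝ) : ℂ) = u := by exact_mod_cast hss
  rw [hsu2, add_mul, mul_right_comm, hS]
  simp only [kirillovSum, ← hs]
  rw [sum_kirillovCoeff_succ, mul_assoc _ _ ((|u| : ℝ) : ℂ), Finset.sum_mul,
    ← mul_left_comm (Real.sqrt |u| : ℂ), ← mul_add, div_mul_eq_mul_div, mul_div_assoc, ← mul_add]
  congr 1
  rw [Finset.sum_div, Finset.mul_sum, ← Finset.sum_add_distrib, ← Finset.sum_add_distrib]
  refine Finset.sum_congr rfl fun j _ => ?_
  rw [← hss2]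
  simp only [Pi.mul_apply]
  rcases j with _ | j
  · simp only [pow_zero, pow_one, Nat.cast_zero, zero_mul, zero_add]
    ring
  · simp only [Nat.add_sub_cancel]
    push_cast
    ring

lemma aestronglyMeasurable_of_continuousAt_ne {f : ℝ → ℂ} (hf : ∀ x, x ≠ 0 → ContinuousAt f x) :
    AEStronglyMeasurable f volume := by
  have h : ContinuousOn f {(0 : ℝ)}ᶜ := fun x hx => (hf x hx).continuousWithinAt
  have h2 := h.aestronglyMeasurable (μ := volume) (measurableSet_singleton (0 : ℝ)).compl
  rwa [restrict_compl_singleton] at h2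

lemma ae_ne_zero_real : ∀ᵐ x : ℝ, x ≠ 0 := by
  simp [ae_iff, measure_singleton]

lemma integrable_comp_abs_of_integrableOn {E : Type*} [NormedAddCommGroup E] {g : ℝ → E}
    (h : IntegrableOn g (Set.Ioi 0)) : Integrable fun x : ℝ => g |x| := by
  have hf : IntegrableOn (fun x => g |x|) (Set.Ioi (0 : ℝ)) :=
    h.congr_fun (fun x hx => by rw [abs_of_pos hx]) measurableSet_Ioi
  have int_Iic : IntegrableOn (fun x => g |x|) (Set.Iic (0 : ℝ)) := by
    rw [← Measure.map_neg_eq_self (volume : Measure ℝ)]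
    let m : MeasurableEmbedding fun x : ℝ => -x := (Homeomorph.neg ℝ).measurableEmbedding
    rw [m.integrableOn_map_iff]
    simp_rw [Function.comp_def, abs_neg, Set.neg_preimage, Set.neg_Iic, neg_zero]
    exact Iff.mpr integrableOn_Ici_iff_integrableOn_Ioi hf
  rw [← integrableOn_univ, ← Set.Iic_union_Ioi (a := (0 : ℝ))]
  exact int_Iic.union hf

lemma integrable_abs_rpow_mul_exp {s c : ℝ} (hs : -1 < s) (hc : 0 < c) :
    Integrable fun x : ℝ => |x| ^ s * Real.exp (-(c * |x|)) := by
  have h := integrableOn_rpow_mul_exp_neg_mul_rpow hs one_pos hc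
  simp only [Real.rpow_one, neg_mul] at h
  exact integrable_comp_abs_of_integrableOn h

lemma rpow_le_const_mul_exp {p ε x : ℝ} (hp0 : 0 ≤ p) (hp1 : p ≤ 1) (hε : 0 < ε) (hx : 0 < x) :
    x ^ p ≤ (1 + 1 / ε) * Real.exp (ε * x) := by
  have h1 : x ^ p ≤ 1 + x := by
    rcases le_total x 1 with h | h
    · exact (Real.rpow_le_one hx.le h hp0).trans (by linarith)
    · exact (Real.rpow_le_rpow_of_exponent_le h hp1).trans (by rw [Real.rpow_one]; linarith)
  have h2 := Real.add_one_le_exp (ε * x)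
  have h3 : 0 < ε * x := by positivity
  have h4 : x = 1 / ε * (ε * x) := by field_simp
  have h5 : 0 < 1 / ε := by positivity
  nlinarith

/-- The building blocks of `besselRep`. -/
noncomputable def besselBranch (μ : ℂ) (x : ℝ) : ℂ :=
  (Real.sqrt |x| : ℂ) * (((2 * Real.pi : ℝ) : ℂ) ^ (2 * μ) * ((|x| : ℝ) : ℂ) ^ μ) *
    besselEntire (2 * μ) (-(4 * Real.pi ^ 2 * x))

lemma besselSeries_eq (μ : ℂ) (ε : ℝ) {x : ℝ} (hx : 0 < x) :
    besselSeries μ ε x = ((x / 2 : ℝ) : ℂ) ^ μ * besselEntire μ (ε * ((x / 2 : ℝ) : ℂ) ^ 2) := by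
  have hx2 : ((x / 2 : ℝ) : ℂ) ≠ 0 := by
    have : x / 2 ≠ 0 := by positivity
    exact_mod_cast this
  rw [besselSeries, besselEntire, ← tsum_mul_left]
  refine tsum_congr fun k => ?_
  rw [Complex.cpow_add _ _ hx2, show (2 * (k : ℂ)) = ((2 * k : ℕ) : ℂ) by push_cast; ring,
    Complex.cpow_natCast, pow_mul, mul_pow]
  ring

lemma besselRep_eq (ν : ℂ) (x : ℝ) :
    besselRep ν x = Real.pi / Complex.sin (Real.pi * ν) *
      (besselBranch (-ν) x - besselBranch ν x) := by
  rcases eq_or_ne x 0 with rfl | hx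
  · simp [besselRep, besselBranch]
  have hs : 0 < Real.sqrt |x| := Real.sqrt_pos.mpr (abs_pos.mpr hx)
  have key : ∀ μ : ℂ, (Real.sqrt |x| : ℂ) * besselSeries (2 * μ) (if 0 < x then -1 else 1)
      (4 * Real.pi * Real.sqrt |x|) = besselBranch μ x := by
    intro μ
    have h2 : 4 * Real.pi * Real.sqrt |x| / 2 = 2 * Real.pi * Real.sqrt |x| := by ring
    have hpow : ((2 * Real.pi * Real.sqrt |x| : ℝ) : ℂ) ^ (2 * μ) =
        ((2 * Real.pi : ℝ) : ℂ) ^ (2 * μ) * ((|x| : ℝ) : ℂ) ^ μ := by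
      rw [Complex.ofReal_mul, Complex.mul_cpow_ofReal_nonneg (by positivity) hs.le]
      congr 1
      have hsc : (Real.sqrt |x| : ℂ) ≠ 0 := by exact_mod_cast hs.ne'
      rw [two_mul μ, Complex.cpow_add _ _ hsc, ← sq_cpow hs, Real.sq_sqrt (abs_nonneg x)]
    rw [besselSeries_eq _ _ (by positivity), h2, hpow, besselBranch, ← mul_assoc]
    congr 2
    rw [← Complex.ofReal_pow, mul_pow, Real.sq_sqrt (abs_nonneg x)]
    rcases lt_or_gt_of_ne hx with h | h
    · rw [if_neg h.not_gt, abs_of_neg h]; push_cast; ring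
    · rw [if_pos h, abs_of_pos h]; push_cast; ring
  rw [besselRep, ← key, ← key, show 2 * -ν = -2 * ν by ring]
  ring

lemma continuousAt_besselBranch (μ : ℂ) {x : ℝ} (hx : x ≠ 0) :
    ContinuousAt (besselBranch μ) x := by
  have h1 : ContinuousAt (fun x : ℝ => ((|x| : ℝ) : ℂ) ^ μ) x := by
    refine ContinuousAt.cpow (f := fun x : ℝ => ((|x| : ℝ) : ℂ)) (by fun_prop)
      continuousAt_const ?_
    exact Complex.ofReal_mem_slitPlane.mpr (abs_pos.mpr hx)
  have h2 : Continuous fun x : ℝ => besselEntire (2 * μ) (-(4 * Real.pi ^ 2 * x)) :=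
    (continuous_besselEntire _).comp (by fun_prop)
  have h3 : Continuous fun x : ℝ => ((Real.sqrt |x| : ℝ) : ℂ) := by fun_prop
  exact (h3.continuousAt.mul (continuousAt_const.mul h1)).mul h2.continuousAt

lemma continuousAt_besselRep (ν : ℂ) {x : ℝ} (hx : x ≠ 0) : ContinuousAt (besselRep ν) x := by
  rw [show besselRep ν = _ from funext (besselRep_eq ν)]
  exact continuousAt_const.mul
    ((continuousAt_besselBranch _ hx).sub (continuousAt_besselBranch _ hx))

lemma exists_norm_besselBranch_le {μ : ℂ} {β : ℝ} (hμ : |μ.re| < β) (hβ : β < 1 / 2)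
    {ε : ℝ} (hε : 0 < ε) : ∃ C : ℝ, 0 ≤ C ∧ ∀ x : ℝ, x ≠ 0 →
      ‖besselBranch μ x‖ ≤ C * (|x| ^ (1 / 2 - β) * Real.exp (ε * |x|)) := by
  obtain ⟨C, hC, h⟩ := exists_norm_besselEntire_le (2 * μ)
    (show 0 < ε / 2 / (4 * Real.pi ^ 2) by positivity)
  set D := ‖((2 * Real.pi : ℝ) : ℂ) ^ (2 * μ)‖ with hD
  refine ⟨D * C * (1 + 1 / (ε / 2)), by positivity, fun x hx => ?_⟩
  have hx' : 0 < |x| := abs_pos.mpr hx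
  have hμ' := abs_lt.mp hμ
  have h1 := h (-(4 * Real.pi ^ 2 * x))
  have h2 : ε / 2 / (4 * Real.pi ^ 2) * ‖(-(4 * Real.pi ^ 2 * x) : ℂ)‖ = ε / 2 * |x| := by
    have : ‖(-(4 * Real.pi ^ 2 * x) : ℂ)‖ = 4 * Real.pi ^ 2 * |x| := by
      rw [norm_neg, norm_mul, norm_mul, norm_pow, Complex.norm_real, Complex.norm_real,
        Real.norm_eq_abs, Real.norm_eq_abs, abs_of_pos Real.pi_pos]
      norm_num
    rw [this]
    field_simp
  rw [h2] at h1
  have h3 := rpow_le_const_mul_exp (p := μ.re + β) (by linarith) (by linarith)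
    (half_pos hε) hx'
  have h4 : Real.sqrt |x| * |x| ^ μ.re = |x| ^ (1 / 2 - β) * |x| ^ (μ.re + β) := by
    rw [Real.sqrt_eq_rpow, ← Real.rpow_add hx', ← Real.rpow_add hx']
    congr 1
    ring
  calc ‖besselBranch μ x‖
      = D * (Real.sqrt |x| * |x| ^ μ.re) *
        ‖besselEntire (2 * μ) (-(4 * Real.pi ^ 2 * x))‖ := by
        rw [besselBranch, norm_mul, norm_mul, norm_mul, Complex.norm_real, Real.norm_eq_abs,
          abs_of_nonneg (Real.sqrt_nonneg _), Complex.norm_cpow_eq_rpow_re_of_pos hx', ← hD]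
        ring
    _ ≤ D * (|x| ^ (1 / 2 - β) * ((1 + 1 / (ε / 2)) * Real.exp (ε / 2 * |x|))) *
        (C * Real.exp (ε / 2 * |x|)) := by
        rw [h4]
        gcongr
    _ = _ := by
        rw [show ε * |x| = ε / 2 * |x| + ε / 2 * |x| by ring, Real.exp_add]
        ring

lemma exists_norm_besselRep_le {ν : ℂ} {β : ℝ} (hν : |ν.re| < β) (hβ : β < 1 / 2)
    {ε : ℝ} (hε : 0 < ε) : ∃ C : ℝ, 0 ≤ C ∧ ∀ x : ℝ, x ≠ 0 →
      ‖besselRep ν x‖ ≤ C * (|x| ^ (1 / 2 - β) * Real.exp (ε * |x|)) := by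
  obtain ⟨C₁, hC₁, h₁⟩ := exists_norm_besselBranch_le (μ := -ν) (by simpa using hν) hβ hε
  obtain ⟨C₂, hC₂, h₂⟩ := exists_norm_besselBranch_le hν hβ hε
  refine ⟨‖(Real.pi : ℂ) / Complex.sin (Real.pi * ν)‖ * (C₁ + C₂), by positivity,
    fun x hx => ?_⟩
  rw [besselRep_eq, norm_mul, mul_assoc, add_mul]
  gcongr
  exact (norm_sub_le _ _).trans (add_le_add (h₁ x hx) (h₂ x hx))

/-- Functions continuous away from `0` that are `O(|x| ^ (1/2 - β))` near `0` and decay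
exponentially at infinity. -/
structure IsKirillovDecaying (β : ℝ) (f : ℝ → ℂ) : Prop where
  continuousAt : ∀ x, x ≠ 0 → ContinuousAt f x
  bound : ∃ C c : ℝ, 0 ≤ C ∧ 0 < c ∧
    ∀ x, x ≠ 0 → ‖f x‖ ≤ C * (|x| ^ (1 / 2 - β) * Real.exp (-(c * |x|)))

namespace IsKirillovDecaying

variable {β : ℝ} {f g : ℝ → ℂ}

lemma add (hf : IsKirillovDecaying β f) (hg : IsKirillovDecaying β g) :
    IsKirillovDecaying β (fun x => f x + g x) := by
  obtain ⟨C₁, c₁, hC₁, hc₁, h₁⟩ := hf.bound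
  obtain ⟨C₂, c₂, hC₂, hc₂, h₂⟩ := hg.bound
  refine ⟨fun x hx => (hf.continuousAt x hx).add (hg.continuousAt x hx),
    C₁ + C₂, min c₁ c₂, by positivity, lt_min hc₁ hc₂, fun x hx => ?_⟩
  rw [add_mul]
  refine (norm_add_le _ _).trans (add_le_add ((h₁ x hx).trans ?_) ((h₂ x hx).trans ?_))
  · gcongr; exact min_le_left _ _
  · gcongr; exact min_le_right _ _

lemma const_mul (hf : IsKirillovDecaying β f) (a : ℂ) :
    IsKirillovDecaying β (fun x => a * f x) := by
  obtain ⟨C, c, hC, hc, h⟩ := hf.bound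
  refine ⟨fun x hx => continuousAt_const.mul (hf.continuousAt x hx),
    ‖a‖ * C, c, by positivity, hc, fun x hx => ?_⟩
  rw [norm_mul, mul_assoc]
  gcongr
  exact h x hx

lemma sub (hf : IsKirillovDecaying β f) (hg : IsKirillovDecaying β g) :
    IsKirillovDecaying β (fun x => f x - g x) := by
  simpa [sub_eq_add_neg] using hf.add (hg.const_mul (-1))

lemma ofReal_mul (hf : IsKirillovDecaying β f) :
    IsKirillovDecaying β (fun x => (x : ℂ) * f x) := by
  obtain ⟨C, c, hC, hc, h⟩ := hf.bound
  refine ⟨fun x hx => Complex.continuous_ofReal.continuousAt.mul (hf.continuousAt x hx),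
    (1 + 1 / (c / 2)) * C, c / 2, by positivity, by positivity, fun x hx => ?_⟩
  have h3 := rpow_le_const_mul_exp (p := 1) (by norm_num) (by norm_num)
    (half_pos hc) (abs_pos.mpr hx)
  rw [Real.rpow_one] at h3
  rw [norm_mul, Complex.norm_real, Real.norm_eq_abs]
  refine (mul_le_mul h3 (h x hx) (norm_nonneg _) (by positivity)).trans (le_of_eq ?_)
  rw [show -(c * |x|) = -(c / 2 * |x|) + -(c / 2 * |x|) by ring, Real.exp_add,
    Real.exp_neg (c / 2 * |x|)]
  field_simp

end IsKirillovDecaying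

/-- The integral operator with kernel the Bessel function of the representation. -/
noncomputable def besselTransform (ν : ℂ) (f : ℝ → ℂ) (u : ℝ) : ℂ :=
  ∫ x : ℝ, besselRep ν (u * x) * f x / ((|x| : ℝ) : ℂ)

lemma IsKirillovDecaying.integrable_kernel {k : ℝ → ℂ} {β : ℝ} (hβ : β < 1 / 2)
    (hk : ∀ x, x ≠ 0 → ContinuousAt k x)
    (hkb : ∀ ε : ℝ, 0 < ε → ∃ C : ℝ, 0 ≤ C ∧ ∀ x : ℝ, x ≠ 0 →
      ‖k x‖ ≤ C * (|x| ^ (1 / 2 - β) * Real.exp (ε * |x|)))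
    {f : ℝ → ℂ} (hf : IsKirillovDecaying β f) {u : ℝ} (hu : u ≠ 0) :
    Integrable fun x : ℝ => k (u * x) * f x / ((|x| : ℝ) : ℂ) := by
  obtain ⟨C, c, hC, hc, h⟩ := hf.bound
  have hu' : 0 < |u| := abs_pos.mpr hu
  obtain ⟨D, hD, h'⟩ := hkb (c / 2 / |u|) (by positivity)
  refine Integrable.mono' ((integrable_abs_rpow_mul_exp (s := -2 * β) (c := c / 2)
    (by linarith) (by positivity)).const_mul (D * |u| ^ (1 / 2 - β) * C)) ?_ ?_
  · refine aestronglyMeasurable_of_continuousAt_ne fun x hx => ?_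
    have h1 : ContinuousAt (fun x : ℝ => k (u * x)) x :=
      ContinuousAt.comp (g := k) (hk _ (mul_ne_zero hu hx))
        (by fun_prop)
    refine (h1.mul (hf.continuousAt x hx)).div (by fun_prop) ?_
    simpa using hx
  · filter_upwards [ae_ne_zero_real] with x hx
    have hx' : 0 < |x| := abs_pos.mpr hx
    have h1 := h' (u * x) (mul_ne_zero hu hx)
    have h2 := h x hx
    rw [norm_div, norm_mul, Complex.norm_real, Real.norm_eq_abs, abs_abs,
      div_le_iff₀ hx']
    refine (mul_le_mul h1 h2 (norm_nonneg _) (by positivity)).trans (le_of_eq ?_)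
    rw [abs_mul, Real.mul_rpow hu'.le hx'.le,
      show c / 2 / |u| * (|u| * |x|) = c / 2 * |x| by field_simp]
    have e1 : |x| ^ (-2 * β) * |x| = |x| ^ (1 / 2 - β) * |x| ^ (1 / 2 - β) := by
      rw [← Real.rpow_add hx', ← Real.rpow_add_one hx'.ne']
      congr 1
      ring
    have e2 : Real.exp (-(c / 2 * |x|)) = Real.exp (c / 2 * |x|) * Real.exp (-(c * |x|)) := by
      rw [← Real.exp_add]
      congr 1
      ring
    rw [e2]
    linear_combination (-(D * |u| ^ (1 / 2 - β) * C * (Real.exp (c / 2 * |x|) *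
      Real.exp (-(c * |x|))))) * e1

lemma IsKirillovDecaying.integrable {ν : ℂ} {β : ℝ} (hν : |ν.re| < β) (hβ : β < 1 / 2)
    {f : ℝ → ℂ} (hf : IsKirillovDecaying β f) {u : ℝ} (hu : u ≠ 0) :
    Integrable fun x : ℝ => besselRep ν (u * x) * f x / ((|x| : ℝ) : ℂ) :=
  hf.integrable_kernel hβ (fun _ hx => continuousAt_besselRep ν hx)
    (fun _ hε => exists_norm_besselRep_le hν hβ hε) hu

lemma besselTransform_eq (ν : ℂ) (f : ℝ → ℂ) {u : ℝ} (hu : u ≠ 0) :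
    besselTransform ν f u = ∫ v : ℝ, besselRep ν v * f (v / u) / ((|v| : ℝ) : ℂ) := by
  have h := Measure.integral_comp_mul_left
    (fun v : ℝ => ((|u| : ℝ) : ℂ) * (besselRep ν v * f (v / u) / ((|v| : ℝ) : ℂ))) u
  have hu' : ((|u| : ℝ) : ℂ) ≠ 0 := by simpa using hu
  rw [integral_const_mul _ fun v : ℝ => besselRep ν v * f (v / u) / ((|v| : ℝ) : ℂ), abs_inv,
    Complex.real_smul, Complex.ofReal_inv, inv_mul_cancel_left₀ hu'] at h
  rw [← h, besselTransform]
  congr 1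
  ext x
  rw [mul_div_cancel_left₀ x hu, abs_mul, Complex.ofReal_mul, mul_div_assoc',
    mul_div_mul_left _ _ hu']

lemma hasDerivAt_besselTransform {ν : ℂ} {β : ℝ} (hν : |ν.re| < β) (hβ : β < 1 / 2)
    {f g : ℝ → ℂ} (hf : IsKirillovDecaying β f) (hg : IsKirillovDecaying β g)
    (hd : ∀ x, x ≠ 0 → HasDerivAt f (g x / x) x) {u : ℝ} (hu : u ≠ 0) :
    HasDerivAt (besselTransform ν f) (-(besselTransform ν g u / u)) u := by
  have hu' : 0 < |u| := abs_pos.mpr hu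
  obtain ⟨C, c, hC, hc, h⟩ := hg.bound
  obtain ⟨D, hD, h'⟩ := exists_norm_besselRep_le hν hβ (show 0 < c / 4 / |u| by positivity)
  have hball : ∀ x ∈ Metric.ball u (|u| / 2), |u| / 2 ≤ |x| ∧ |x| ≤ 2 * |u| := by
    intro x hx
    rw [Metric.mem_ball, Real.dist_eq] at hx
    have h1 := abs_sub_abs_le_abs_sub u x
    have h2 := abs_sub_abs_le_abs_sub x u
    rw [abs_sub_comm] at h1
    constructor <;> linarith
  have hne : ∀ x ∈ Metric.ball u (|u| / 2), x ≠ 0 := fun x hx =>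
    abs_pos.mp ((half_pos hu').trans_le (hball x hx).1)
  have hmem : Metric.ball u (|u| / 2) ∈ nhds u := Metric.ball_mem_nhds u (half_pos hu')
  have hmeas : ∀ (φ : ℝ → ℂ), IsKirillovDecaying β φ → ∀ x, x ≠ 0 →
      AEStronglyMeasurable (fun v : ℝ => besselRep ν v * φ (v / x) / ((|v| : ℝ) : ℂ)) := by
    intro φ hφ x hx
    refine aestronglyMeasurable_of_continuousAt_ne fun v hv => ?_
    have h1 : ContinuousAt (fun v : ℝ => φ (v / x)) v :=
      ContinuousAt.comp (g := φ) (hφ.continuousAt _ (div_ne_zero hv hx)) (by fun_prop)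
    refine ((continuousAt_besselRep ν hv).mul h1).div (by fun_prop) ?_
    simpa using hv
  have key := hasDerivAt_integral_of_dominated_loc_of_deriv_le (μ := volume)
    (F := fun x v : ℝ => besselRep ν v * f (v / x) / ((|v| : ℝ) : ℂ))
    (F' := fun x v : ℝ => -(besselRep ν v * g (v / x) / ((|v| : ℝ) : ℂ)) / x)
    (bound := fun v => D * C * (2 / |u|) ^ (1 / 2 - β) * (2 / |u|) *
      (|v| ^ (-2 * β) * Real.exp (-(c / 4 / |u| * |v|))))
    (x₀ := u) hmem ?_ ?_ ?_ ?_ ?_ ?_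
  · refine (key.2.congr_of_eventuallyEq ?_).congr_deriv ?_
    · filter_upwards [hmem] with x hx
      exact besselTransform_eq ν f (hne x hx)
    · rw [besselTransform_eq ν g hu, integral_div, integral_neg, neg_div]
  · filter_upwards [hmem] with x hx
    exact hmeas f hf x (hne x hx)
  · refine (((hf.integrable hν hβ hu).comp_div hu).div_const ((|u| : ℝ) : ℂ)).congr
      (Filter.Eventually.of_forall fun v => ?_)
    have huc : ((|u| : ℝ) : ℂ) ≠ 0 := by simpa using hu
    simp only
    rw [mul_div_cancel₀ v hu, abs_div, Complex.ofReal_div, div_div, div_mul_cancel₀ _ huc]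
  · simp only [div_eq_mul_inv _ (u : ℂ)]
    exact (hmeas g hg u hu).neg.mul_const _
  · filter_upwards [ae_ne_zero_real] with v hv x hx
    have hv' : 0 < |v| := abs_pos.mpr hv
    obtain ⟨hx1, hx2⟩ := hball x hx
    have hx0 : 0 < |x| := (half_pos hu').trans_le hx1
    have h1 := h' v hv
    have h2 := h (v / x) (div_ne_zero hv (hne x hx))
    have h3 : |v / x| ^ (1 / 2 - β) * Real.exp (-(c * |v / x|)) ≤
        (2 / |u|) ^ (1 / 2 - β) * |v| ^ (1 / 2 - β) * Real.exp (-(c / 2 / |u| * |v|)) := by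
      rw [← Real.mul_rpow (by positivity) hv'.le, abs_div]
      have e1 : |v| / |x| ≤ 2 / |u| * |v| := by
        rw [div_le_iff₀ hx0]
        have : 2 / |u| * |v| * (|u| / 2) = |v| := by field_simp
        nlinarith [mul_le_mul_of_nonneg_left hx1 (show 0 ≤ 2 / |u| * |v| by positivity)]
      have e2 : c / 2 / |u| * |v| ≤ c * (|v| / |x|) := by
        rw [show c / 2 / |u| * |v| = c * (|v| / (2 * |u|)) by field_simp]
        gcongr
      have : 0 ≤ 1 / 2 - β := by linarith
      gcongr
    have h4 : |x|⁻¹ ≤ 2 / |u| := by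
      rw [← inv_div]
      exact inv_anti₀ (half_pos hu') hx1
    rw [norm_div, norm_neg, norm_div, norm_mul, Complex.norm_real, Complex.norm_real,
      Real.norm_eq_abs, Real.norm_eq_abs, abs_abs]
    have h5 : |v| ^ (-2 * β) = |v| ^ (1 / 2 - β) * |v| ^ (1 / 2 - β) / |v| := by
      rw [eq_div_iff hv'.ne', ← Real.rpow_add hv', ← Real.rpow_add_one hv'.ne']
      congr 1
      ring
    calc ‖besselRep ν v‖ * ‖g (v / x)‖ / |v| / |x|
        ≤ (D * (|v| ^ (1 / 2 - β) * Real.exp (c / 4 / |u| * |v|))) *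
          (C * ((2 / |u|) ^ (1 / 2 - β) * |v| ^ (1 / 2 - β) *
            Real.exp (-(c / 2 / |u| * |v|)))) / |v| * (2 / |u|) := by
          rw [div_eq_mul_inv _ |x|]
          gcongr
          exact h2.trans (mul_le_mul_of_nonneg_left h3 hC)
      _ = _ := by
          rw [h5, show -(c / 4 / |u| * |v|) = c / 4 / |u| * |v| + -(c / 2 / |u| * |v|) by ring,
            Real.exp_add]
          ring
  · refine (integrable_abs_rpow_mul_exp (by linarith) (by positivity)).const_mul _
  · filter_upwards [ae_ne_zero_real] with v hv x hx
    have hx0 := hne x hx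
    have hxc : (x : ℂ) ≠ 0 := by exact_mod_cast hx0
    have hvc : (v : ℂ) ≠ 0 := by exact_mod_cast hv
    have h1 : HasDerivAt (fun x : ℝ => v / x) (-(v / x ^ 2)) x := by
      simpa [div_eq_mul_inv] using (hasDerivAt_inv hx0).const_mul v
    have h2 := (hd (v / x) (div_ne_zero hv hx0)).scomp x h1
    refine ((h2.const_mul (besselRep ν v)).div_const ((|v| : ℝ) : ℂ)).congr_deriv ?_
    rw [Complex.real_smul]
    push_cast
    field_simp

lemma besselTransform_congr {ν : ℂ} {f g : ℝ → ℂ} (h : ∀ x, x ≠ 0 → f x = g x) (u : ℝ) :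
    besselTransform ν f u = besselTransform ν g u := by
  refine integral_congr_ae ?_
  filter_upwards [ae_ne_zero_real] with x hx
  rw [h x hx]

lemma besselTransform_const_mul (ν a : ℂ) (f : ℝ → ℂ) (u : ℝ) :
    besselTransform ν (fun x => a * f x) u = a * besselTransform ν f u := by
  rw [besselTransform, besselTransform, ← integral_const_mul]
  congr 1
  ext x
  ring

lemma besselTransform_add {ν : ℂ} {β : ℝ} (hν : |ν.re| < β) (hβ : β < 1 / 2) {f g : ℝ → ℂ}
    (hf : IsKirillovDecaying β f) (hg : IsKirillovDecaying β g) {u : ℝ} (hu : u ≠ 0) :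
    besselTransform ν (fun x => f x + g x) u = besselTransform ν f u + besselTransform ν g u := by
  rw [besselTransform, besselTransform, besselTransform,
    ← integral_add (hf.integrable hν hβ hu) (hg.integrable hν hβ hu)]
  congr 1
  ext x
  ring

lemma integral_pow_mul_exp_neg_div (m : ℕ) {y : ℝ} (hy : 0 < y) :
    ∫ x : ℝ, x ^ (2 * m) * Real.exp (-((Real.pi * |x|) ^ 2 / y)) =
      (Real.pi ^ (2 * m + 1))⁻¹ * Real.Gamma (m + 1 / 2) * y ^ ((m : ℝ) + 1 / 2) := by
  have hpi := Real.pi_pos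
  have h1 : (fun x : ℝ => x ^ (2 * m) * Real.exp (-((Real.pi * |x|) ^ 2 / y))) = fun x : ℝ =>
      (fun z : ℝ => z ^ ((2 * m : ℕ) : ℝ) * Real.exp (-(Real.pi ^ 2 / y) * z ^ (2 : ℝ))) |x| := by
    ext x
    simp only
    rw [Real.rpow_natCast, pow_mul |x|, sq_abs, ← pow_mul, Real.rpow_two, mul_pow]
    congr 2
    ring
  have hq : (-1 : ℝ) < ((2 * m : ℕ) : ℝ) := lt_of_lt_of_le (by norm_num) (Nat.cast_nonneg _)
  rw [h1, integral_comp_abs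
    (f := fun z : ℝ => z ^ ((2 * m : ℕ) : ℝ) * Real.exp (-(Real.pi ^ 2 / y) * z ^ (2 : ℝ))),
    integral_rpow_mul_exp_neg_mul_rpow two_pos hq (by positivity)]
  have h2 : (((2 * m : ℕ) : ℝ) + 1) / 2 = m + 1 / 2 := by push_cast; ring
  have h3 : -(((2 * m : ℕ) : ℝ) + 1) / 2 = -((m : ℝ) + 1 / 2) := by push_cast; ring
  rw [h2, h3, Real.div_rpow (by positivity) hy.le, Real.rpow_neg hy.le,
    Real.rpow_neg (by positivity), ← Real.rpow_natCast Real.pi 2, ← Real.rpow_mul hpi.le,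
    ← Real.rpow_natCast Real.pi (2 * m + 1)]
  rw [show ((2 : ℕ) : ℝ) * ((m : ℝ) + 1 / 2) = ((2 * m + 1 : ℕ) : ℝ) by push_cast; ring]
  field_simp

lemma integrable_pow_mul_exp_neg_div (m : ℕ) {y : ℝ} (hy : 0 < y) :
    Integrable fun x : ℝ => x ^ (2 * m) * Real.exp (-((Real.pi * |x|) ^ 2 / y)) := by
  refine Integrable.of_integral_ne_zero ?_
  rw [integral_pow_mul_exp_neg_div m hy]
  have := Real.Gamma_pos_of_pos (show (0 : ℝ) < m + 1 / 2 by positivity)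
  positivity

lemma integral_pow_mul_macdonald_even {μ : ℂ} (hμ : -(1 / 2) < μ.re) (m : ℕ) :
    ∫ x : ℝ, (x : ℂ) ^ (2 * m) * macdonald μ ((Real.pi * |x|) ^ 2) =
      ((Real.pi : ℂ) ^ (2 * m + 1))⁻¹ * Complex.Gamma (m + 1 / 2) *
        Complex.Gamma (μ + m + 1 / 2) := by
  have hpi := Real.pi_pos
  have hs : 0 < (μ + m + 1 / 2).re := by
    have : (0 : ℝ) ≤ m := Nat.cast_nonneg m
    simp
    linarith
  set F : ℝ → ℝ → ℂ := fun x y => (x : ℂ) ^ (2 * m) *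
    ((y : ℂ) ^ (μ - 1) * (Real.exp (-(y + (Real.pi * |x|) ^ 2 / y)) : ℂ)) with hF
  have hF2 : ∀ x y, F x y = ((y : ℂ) ^ (μ - 1) * (Real.exp (-y) : ℂ)) *
      ((x ^ (2 * m) * Real.exp (-((Real.pi * |x|) ^ 2 / y)) : ℝ) : ℂ) := by
    intro x y
    simp only [hF]
    rw [neg_add, Real.exp_add]
    push_cast
    ring
  have hnorm : ∀ x y, 0 < y → ‖F x y‖ = (y ^ (μ.re - 1) * Real.exp (-y)) *
      (x ^ (2 * m) * Real.exp (-((Real.pi * |x|) ^ 2 / y))) := by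
    intro x y hy
    rw [hF2, norm_mul, norm_mul, Complex.norm_cpow_eq_rpow_re_of_pos hy, Complex.norm_real,
      Complex.norm_real, Real.norm_eq_abs, Real.norm_eq_abs, Real.abs_exp, Complex.sub_re,
      Complex.one_re, abs_of_nonneg]
    rw [pow_mul]
    positivity
  have hmeas : Measurable (Function.uncurry F) := by
    simp only [hF]
    unfold Function.uncurry
    fun_prop
  have hint : Integrable (Function.uncurry F)
      (volume.prod (volume.restrict (Set.Ioi (0 : ℝ)))) := by
    rw [integrable_prod_iff' hmeas.aestronglyMeasurable]
    constructor
    · filter_upwards [ae_restrict_mem measurableSet_Ioi] with y hy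
      simp only [Function.uncurry, hF2]
      exact (integrable_pow_mul_exp_neg_div m hy).ofReal.const_mul _
    · have h1 := (Real.GammaIntegral_convergent hs).const_mul
        ((Real.pi ^ (2 * m + 1))⁻¹ * Real.Gamma (m + 1 / 2))
      refine IntegrableOn.congr_fun h1 (fun y hy => ?_) measurableSet_Ioi
      have hy' : 0 < y := hy
      simp only [Function.uncurry, hnorm _ _ hy']
      rw [integral_const_mul, integral_pow_mul_exp_neg_div m hy']
      have : y ^ ((μ + m + 1 / 2).re - 1) = y ^ (μ.re - 1) * y ^ ((m : ℝ) + 1 / 2) := by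
        rw [← Real.rpow_add hy']
        congr 1
        simp
        ring
      rw [this]
      ring
  have hswap := integral_integral_swap hint
  have hl : (∫ x : ℝ, (x : ℂ) ^ (2 * m) * macdonald μ ((Real.pi * |x|) ^ 2)) =
      ∫ x : ℝ, ∫ y in Set.Ioi (0 : ℝ), F x y := by
    simp only [hF, macdonald, integral_const_mul]
  rw [hl, hswap, Complex.Gamma_eq_integral hs, Complex.GammaIntegral, ← integral_const_mul]
  refine setIntegral_congr_fun measurableSet_Ioi fun y hy => ?_
  have hy' : 0 < y := hy
  have hyc : (y : ℂ) ≠ 0 := by exact_mod_cast hy'.ne'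
  simp only [hF2]
  rw [integral_const_mul, integral_complex_ofReal, integral_pow_mul_exp_neg_div m hy']
  push_cast
  rw [Complex.ofReal_cpow hy'.le, ← Complex.Gamma_ofReal]
  push_cast
  rw [show μ + m + 1 / 2 - 1 = (μ - 1) + (m + 1 / 2) by ring,
    Complex.cpow_add (μ - 1) (m + 1 / 2) hyc]
  ring

lemma integral_pow_mul_macdonald_odd (μ : ℂ) (m : ℕ) :
    ∫ x : ℝ, (x : ℂ) ^ (2 * m + 1) * macdonald μ ((Real.pi * |x|) ^ 2) = 0 := by
  have h := integral_neg_eq_self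
    (fun x : ℝ => (x : ℂ) ^ (2 * m + 1) * macdonald μ ((Real.pi * |x|) ^ 2)) volume
  simp only [abs_neg, Complex.ofReal_neg, (odd_two_mul_add_one m).neg_pow, neg_mul,
    integral_neg] at h
  linear_combination (-1 / 2 : ℂ) * h

lemma continuousAt_macdonald_sq (μ : ℂ) {x : ℝ} (hx : x ≠ 0) :
    ContinuousAt (fun x : ℝ => macdonald μ ((Real.pi * |x|) ^ 2)) x := by
  have h0 : 0 < (Real.pi * |x|) ^ 2 := by
    have := abs_pos.mpr hx
    positivity
  exact ContinuousAt.comp (g := macdonald μ) (hasDerivAt_macdonald μ h0).continuousAt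
    (f := fun x : ℝ => (Real.pi * |x|) ^ 2) (by fun_prop)

lemma exists_norm_macdonald_sq_le {μ : ℂ} {β : ℝ} (hβ : 0 < β) (hμ : |μ.re| ≤ β) :
    ∃ C : ℝ, 0 ≤ C ∧ ∀ x : ℝ, x ≠ 0 → ‖macdonald μ ((Real.pi * |x|) ^ 2)‖ ≤
      C * (|x| ^ (μ.re - β) * Real.exp (-(Real.pi * |x|))) := by
  obtain ⟨C, hC, h⟩ := exists_norm_besselKInt_le hβ hμ
  refine ⟨Real.pi ^ μ.re * C, by positivity, fun x hx => ?_⟩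
  have hx' := abs_pos.mpr hx
  have hpi := Real.pi_pos
  rw [macdonald_sq_eq _ hx', norm_mul, Complex.norm_cpow_eq_rpow_re_of_pos (by positivity),
    Real.mul_rpow hpi.le hx'.le, Real.rpow_sub hx', div_eq_mul_inv, ← Real.rpow_neg hx'.le]
  calc _ ≤ Real.pi ^ μ.re * |x| ^ μ.re * (C * (|x| ^ (-β) * Real.exp (-(Real.pi * |x|)))) := by
        gcongr
        exact h _ hx'
    _ = _ := by ring

lemma hasSum_integral_mul_besselEntire {κ : ℂ} {W : ℝ → ℂ} {s C c : ℝ} (hs : -1 < s)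
    (hc : 0 < c) (hW : ∀ x, x ≠ 0 → ContinuousAt W x)
    (hb : ∀ x, x ≠ 0 → ‖W x‖ ≤ C * (|x| ^ s * Real.exp (-(c * |x|)))) (w : ℂ) :
    HasSum (fun n : ℕ => w ^ n / ((n.factorial : ℂ) * Complex.Gamma (κ + n + 1)) *
      ∫ x : ℝ, (x : ℂ) ^ n * W x) (∫ x : ℝ, besselEntire κ (w * x) * W x) := by
  obtain ⟨D, hD, h⟩ := exists_norm_besselEntire_term_le κ
    (show 0 < c / 2 / (‖w‖ + 1) by positivity)
  have key : ∀ n : ℕ, w ^ n / ((n.factorial : ℂ) * Complex.Gamma (κ + n + 1)) *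
      ∫ x : ℝ, (x : ℂ) ^ n * W x = ∫ x : ℝ,
      (w * x) ^ n / ((n.factorial : ℂ) * Complex.Gamma (κ + n + 1)) * W x := by
    intro n
    rw [← integral_const_mul]
    congr 1
    ext x
    rw [mul_pow]
    ring
  simp only [key]
  have hexp : ∀ x : ℝ, HasSum (fun n : ℕ => (c / 2 * |x|) ^ n / (n.factorial : ℝ))
      (Real.exp (c / 2 * |x|)) := by
    intro x
    rw [Real.exp_eq_exp_ℝ]
    exact NormedSpace.expSeries_div_hasSum_exp (c / 2 * |x|)
  have hsum : ∀ x : ℝ, HasSum (fun n : ℕ => D * ((c / 2 * |x|) ^ n / (n.factorial : ℝ)) *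
      (C * (|x| ^ s * Real.exp (-(c * |x|)))))
      (D * Real.exp (c / 2 * |x|) * (C * (|x| ^ s * Real.exp (-(c * |x|))))) :=
    fun x => ((hexp x).mul_left D).mul_right _
  refine hasSum_integral_of_dominated_convergence
    (fun n x => D * ((c / 2 * |x|) ^ n / (n.factorial : ℝ)) *
      (C * (|x| ^ s * Real.exp (-(c * |x|))))) (fun n => ?_) (fun n => ?_) ?_ ?_ ?_
  · exact aestronglyMeasurable_of_continuousAt_ne fun x hx =>
      ContinuousAt.mul (by fun_prop) (hW x hx)
  · filter_upwards [ae_ne_zero_real] with x hx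
    rw [norm_mul]
    refine mul_le_mul ((h n (w * x)).trans ?_) (hb x hx) (norm_nonneg _) (by positivity)
    rw [norm_mul, Complex.norm_real, Real.norm_eq_abs]
    have : c / 2 / (‖w‖ + 1) * (‖w‖ * |x|) ≤ c / 2 * |x| := by
      rw [div_mul_eq_mul_div, div_le_iff₀ (by positivity)]
      have : 0 ≤ c / 2 * |x| := by positivity
      nlinarith
    gcongr
  · exact Filter.Eventually.of_forall fun x => (hsum x).summable
  · simp only [(hsum _).tsum_eq]
    refine ((integrable_abs_rpow_mul_exp hs (half_pos hc)).const_mul (D * C)).congr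
      (Filter.Eventually.of_forall fun x => ?_)
    have e2 : Real.exp (-(c / 2 * |x|)) = Real.exp (c / 2 * |x|) * Real.exp (-(c * |x|)) := by
      rw [← Real.exp_add]
      congr 1
      ring
    simp only [e2]
    ring
  · exact Filter.Eventually.of_forall fun x => (hasSum_besselEntire κ (w * x)).mul_right _

lemma Gamma_mul_Gamma_nat (μ : ℂ) (k : ℕ) :
    Complex.Gamma (μ + (k + 1) / 2) * Complex.Gamma (μ + k / 2 + 1) =
      Complex.Gamma (2 * μ + k + 1) * ((2 : ℂ) ^ (-(2 * μ)) * ((2 : ℂ) ^ k)⁻¹) *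
        (Real.sqrt Real.pi : ℂ) := by
  have h := Complex.Gamma_mul_Gamma_add_half (μ + (k + 1) / 2)
  rw [show μ + (k + 1) / 2 + 1 / 2 = μ + k / 2 + 1 by ring,
    show 2 * (μ + ((k : ℂ) + 1) / 2) = 2 * μ + k + 1 by ring,
    show 1 - (2 * μ + (k : ℂ) + 1) = -(2 * μ) - k by ring,
    Complex.cpow_sub _ _ two_ne_zero, Complex.cpow_natCast, div_eq_mul_inv] at h
  exact h

lemma Gamma_mul_Gamma_nat_zero (k : ℕ) :
    Complex.Gamma ((k + 1) / 2) * Complex.Gamma (k / 2 + 1) =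
      (k.factorial : ℂ) * ((2 : ℂ) ^ k)⁻¹ * (Real.sqrt Real.pi : ℂ) := by
  have h := Gamma_mul_Gamma_nat 0 k
  simpa [Complex.Gamma_nat_eq_factorial] using h

lemma sqrt_pi_mul_self : (Real.sqrt Real.pi : ℂ) * (Real.sqrt Real.pi : ℂ) = Real.pi := by
  rw [← Complex.ofReal_mul, Real.mul_self_sqrt Real.pi_pos.le]

lemma Gamma_add_nat_ne_zero {μ : ℂ} (hμ : -1 < μ.re) (m : ℕ) :
    Complex.Gamma (μ + m + 1) ≠ 0 := by
  refine Complex.Gamma_ne_zero_of_re_pos ?_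
  have : (0 : ℝ) ≤ m := Nat.cast_nonneg m
  simp
  linarith

lemma integral_besselEntire_mul_macdonald {μ : ℂ} (hμ : |μ.re| < 1 / 2) (u : ℝ) :
    ∫ x : ℝ, besselEntire (2 * μ) (-(4 * Real.pi ^ 2 * u) * x) *
      macdonald μ ((Real.pi * |x|) ^ 2) =
      (2 : ℂ) ^ (-(2 * μ)) * besselEntire μ ((Real.pi * u) ^ 2) := by
  obtain ⟨β, h1, h2⟩ := exists_between hμ
  have hβ : 0 < β := (abs_nonneg _).trans_lt h1
  have hμ' := abs_lt.mp h1
  obtain ⟨C, hC, hb⟩ := exists_norm_macdonald_sq_le hβ h1.le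
  have h := hasSum_integral_mul_besselEntire (κ := 2 * μ) (by linarith) Real.pi_pos
    (fun x hx => continuousAt_macdonald_sq μ hx) hb (-(4 * Real.pi ^ 2 * u))
  have hinj : Function.Injective fun m : ℕ => 2 * m := fun a b hab => by simpa using hab
  rw [← hinj.hasSum_iff] at h
  · refine h.unique (((hasSum_besselEntire μ ((Real.pi * u) ^ 2)).mul_left _).congr_fun
      fun m => ?_)
    have d1 := Gamma_mul_Gamma_nat_zero (2 * m)
    have d2 := Gamma_mul_Gamma_nat μ (2 * m)
    have e1 : (((2 * m : ℕ) : ℂ) + 1) / 2 = m + 1 / 2 := by push_cast; ring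
    have e2 : (((2 * m : ℕ) : ℂ)) / 2 = m := by push_cast; ring
    rw [e1, e2, Complex.Gamma_nat_eq_factorial] at d1
    rw [e1, e2, ← add_assoc] at d2
    simp only [Function.comp_apply]
    rw [integral_pow_mul_macdonald_even (by linarith)]
    have n1 := Gamma_add_nat_ne_zero (μ := μ) (by linarith) m
    have n2 := Gamma_add_nat_ne_zero (μ := 2 * μ)
      (by simp; linarith) (2 * m)
    have n3 : ((m.factorial : ℕ) : ℂ) ≠ 0 := by exact_mod_cast m.factorial_ne_zero
    have n4 : (((2 * m).factorial : ℕ) : ℂ) ≠ 0 := by exact_mod_cast (2 * m).factorial_ne_zero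
    have n5 : (Real.pi : ℂ) ≠ 0 := by exact_mod_cast Real.pi_ne_zero
    have hpow : (-(4 * Real.pi ^ 2 * u) : ℂ) ^ (2 * m) =
        (2 ^ (2 * m)) * 2 ^ (2 * m) * (Real.pi ^ (2 * m) * ((Real.pi * u) ^ 2) ^ m) := by
      simp only [pow_mul, ← mul_pow]
      congr 1
      ring
    rw [hpow, ← mul_div_assoc, div_mul_eq_mul_div,
      div_eq_div_iff (mul_ne_zero n4 n2) (mul_ne_zero n3 n1), pow_succ]
    have prod : (Complex.Gamma (m + 1 / 2) * m.factorial) *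
        (Complex.Gamma (μ + m + 1 / 2) * Complex.Gamma (μ + m + 1)) * (2 ^ (2 * m) * 2 ^ (2 * m)) =
        ((2 * m).factorial * Complex.Gamma (2 * μ + (2 * m : ℕ) + 1)) *
          (2 : ℂ) ^ (-(2 * μ)) * Real.pi := by
      rw [d1, d2, ← sqrt_pi_mul_self]
      field_simp
    generalize Complex.Gamma ((m : ℂ) + 1 / 2) = G₁ at prod ⊢
    generalize Complex.Gamma (μ + m + 1 / 2) = G₂ at prod ⊢
    generalize Complex.Gamma (μ + m + 1) = G₃ at prod n1 ⊢
    generalize Complex.Gamma (2 * μ + (2 * m : ℕ) + 1) = G₄ at prod n2 ⊢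
    generalize (2 : ℂ) ^ (-(2 * μ)) = T at prod ⊢
    field_simp
    linear_combination (Real.pi : ℂ) ^ (2 * m) * ((Real.pi * u : ℂ) ^ 2) ^ m * prod
  · intro n hn
    obtain ⟨m, rfl | rfl⟩ := n.even_or_odd'
    · exact absurd ⟨m, rfl⟩ hn
    · rw [integral_pow_mul_macdonald_odd, mul_zero]

lemma integral_besselEntire_mul_macdonald_mul {μ : ℂ} (hμ : |μ.re| < 1 / 2) (u : ℝ) :
    ∫ x : ℝ, besselEntire (2 * μ) (-(4 * Real.pi ^ 2 * u) * x) *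
      (x * macdonald μ ((Real.pi * |x|) ^ 2)) =
      -u * ((2 : ℂ) ^ (-(2 * μ)) * besselEntire μ ((Real.pi * u) ^ 2)) := by
  obtain ⟨β, h1, h2⟩ := exists_between hμ
  have hβ : 0 < β := (abs_nonneg _).trans_lt h1
  have hμ' := abs_lt.mp h1
  obtain ⟨C, hC, hb⟩ := exists_norm_macdonald_sq_le hβ h1.le
  have h := hasSum_integral_mul_besselEntire (κ := 2 * μ)
    (W := fun x => x * macdonald μ ((Real.pi * |x|) ^ 2)) (s := μ.re - β + 1) (C := C)
    (by linarith) Real.pi_pos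
    (fun x hx => Complex.continuous_ofReal.continuousAt.mul (continuousAt_macdonald_sq μ hx))
    (fun x hx => by
      rw [norm_mul, Complex.norm_real, Real.norm_eq_abs,
        Real.rpow_add_one (abs_pos.mpr hx).ne']
      have := mul_le_mul_of_nonneg_left (hb x hx) (abs_nonneg x)
      linarith) (-(4 * Real.pi ^ 2 * u))
  simp only [← mul_assoc, ← pow_succ] at h ⊢
  have hinj : Function.Injective fun m : ℕ => 2 * m + 1 := fun a b hab => by simpa using hab
  rw [← hinj.hasSum_iff] at h
  · refine h.unique (((hasSum_besselEntire μ ((Real.pi * u) ^ 2)).mul_left _).congr_fun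
      fun m => ?_)
    have d1 := Gamma_mul_Gamma_nat_zero (2 * m + 1)
    have d2 := Gamma_mul_Gamma_nat μ (2 * m + 1)
    have e1 : (((2 * m + 1 : ℕ) : ℂ) + 1) / 2 = m + 1 := by push_cast; ring
    have e2 : (((2 * m + 1 : ℕ) : ℂ)) / 2 + 1 = (m + 1 : ℕ) + 1 / 2 := by push_cast; ring
    rw [e1, e2, Complex.Gamma_nat_eq_factorial] at d1
    rw [e1, add_assoc μ _ 1, e2, ← add_assoc, ← add_assoc] at d2
    simp only [Function.comp_apply]
    rw [show 2 * m + 1 + 1 = 2 * (m + 1) by ring,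
      integral_pow_mul_macdonald_even (by linarith)]
    have n1 := Gamma_add_nat_ne_zero (μ := μ) (by linarith) m
    have n2 := Gamma_add_nat_ne_zero (μ := 2 * μ)
      (by simp; linarith) (2 * m + 1)
    have n3 : ((m.factorial : ℕ) : ℂ) ≠ 0 := by exact_mod_cast m.factorial_ne_zero
    have n4 : (((2 * m + 1).factorial : ℕ) : ℂ) ≠ 0 := by
      exact_mod_cast (2 * m + 1).factorial_ne_zero
    have n5 : (Real.pi : ℂ) ≠ 0 := by exact_mod_cast Real.pi_ne_zero
    have hpow : (-(4 * Real.pi ^ 2 * u) : ℂ) ^ (2 * m + 1) =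
        -u * Real.pi ^ 2 * ((2 ^ (2 * m + 1)) * 2 ^ (2 * m + 1) *
          (Real.pi ^ (2 * m) * ((Real.pi * u) ^ 2) ^ m)) := by
      have : (-(4 * Real.pi ^ 2 * u) : ℂ) ^ (2 * m) =
        (2 ^ (2 * m)) * 2 ^ (2 * m) * (Real.pi ^ (2 * m) * ((Real.pi * u) ^ 2) ^ m) := by
        simp only [pow_mul, ← mul_pow]
        congr 1
        ring
      rw [pow_succ, this]
      ring
    rw [hpow, ← mul_div_assoc, div_mul_eq_mul_div,
      div_eq_div_iff (mul_ne_zero n4 n2) (mul_ne_zero n3 n1),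
      show 2 * (m + 1) + 1 = 2 * m + 3 by ring, pow_add (Real.pi : ℂ) (2 * m) 3]
    have prod : (m.factorial * Complex.Gamma ((m + 1 : ℕ) + 1 / 2)) *
        (Complex.Gamma (μ + m + 1) * Complex.Gamma (μ + (m + 1 : ℕ) + 1 / 2)) *
        (2 ^ (2 * m + 1) * 2 ^ (2 * m + 1)) =
        ((2 * m + 1).factorial * Complex.Gamma (2 * μ + (2 * m + 1 : ℕ) + 1)) *
          (2 : ℂ) ^ (-(2 * μ)) * Real.pi := by
      rw [d1, d2, ← sqrt_pi_mul_self]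
      field_simp
    generalize Complex.Gamma (((m + 1 : ℕ) : ℂ) + 1 / 2) = G₁ at prod ⊢
    generalize Complex.Gamma (μ + (m + 1 : ℕ) + 1 / 2) = G₂ at prod ⊢
    generalize Complex.Gamma (μ + m + 1) = G₃ at prod n1 ⊢
    generalize Complex.Gamma (2 * μ + (2 * m + 1 : ℕ) + 1) = G₄ at prod n2 ⊢
    generalize (2 : ℂ) ^ (-(2 * μ)) = T at prod ⊢
    field_simp
    linear_combination (-u : ℂ) * ((Real.pi * u : ℂ) ^ 2) ^ m * prod
  · intro n hn
    obtain ⟨m, rfl | rfl⟩ := n.even_or_odd'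
    · rw [integral_pow_mul_macdonald_odd, mul_zero]
    · exact absurd ⟨m, rfl⟩ hn

/-- The spherical Kirillov vector, up to its normalising constant. -/
noncomputable def sphericalVec (ν : ℂ) (u : ℝ) : ℂ := (Real.sqrt |u| : ℂ) * besselKInt ν |u|

lemma sphericalVec_neg (ν : ℂ) {u : ℝ} (hu : u ≠ 0) : sphericalVec (-ν) u = sphericalVec ν u := by
  rw [sphericalVec, besselKInt_neg _ (abs_pos.mpr hu), sphericalVec]

lemma isKirillovDecaying_sqrt_mul_besselKInt {a : ℂ} {β : ℝ} (hβ : 0 < β) (ha : |a.re| ≤ β) :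
    IsKirillovDecaying β (fun x => (Real.sqrt |x| : ℂ) * besselKInt a |x|) := by
  obtain ⟨C, hC, h⟩ := exists_norm_besselKInt_le hβ ha
  refine ⟨fun x hx => ?_, C, Real.pi, hC, Real.pi_pos, fun x hx => ?_⟩
  · refine ContinuousAt.mul (by fun_prop) ?_
    exact ContinuousAt.comp (g := besselKInt a)
      (hasDerivAt_besselKInt a (abs_pos.mpr hx)).continuousAt (by fun_prop)
  · have hx' := abs_pos.mpr hx
    rw [norm_mul, Complex.norm_real, Real.norm_eq_abs, abs_of_nonneg (Real.sqrt_nonneg _),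
      sub_eq_add_neg, Real.rpow_add hx', ← Real.sqrt_eq_rpow]
    have := mul_le_mul_of_nonneg_left (h _ hx') (Real.sqrt_nonneg |x|)
    linarith

lemma isKirillovDecaying_sqrt_mul_abs_mul_besselKInt {a : ℂ} {β : ℝ} (hβ : 0 < β)
    (ha : |a.re| ≤ β + 1) :
    IsKirillovDecaying β
      (fun x => (Real.sqrt |x| : ℂ) * (((|x| : ℝ) : ℂ) * besselKInt a |x|)) := by
  obtain ⟨C, hC, h⟩ := exists_norm_besselKInt_le (by linarith) ha
  refine ⟨fun x hx => ?_, C, Real.pi, hC, Real.pi_pos, fun x hx => ?_⟩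
  · refine ContinuousAt.mul (by fun_prop) (ContinuousAt.mul (by fun_prop) ?_)
    exact ContinuousAt.comp (g := besselKInt a)
      (hasDerivAt_besselKInt a (abs_pos.mpr hx)).continuousAt (by fun_prop)
  · have hx' := abs_pos.mpr hx
    rw [norm_mul, norm_mul, Complex.norm_real, Complex.norm_real, Real.norm_eq_abs,
      Real.norm_eq_abs, abs_abs, abs_of_nonneg (Real.sqrt_nonneg _),
      show 1 / 2 - β = 1 / 2 + (1 + -(β + 1)) by ring, Real.rpow_add hx', Real.rpow_add hx',
      ← Real.sqrt_eq_rpow, Real.rpow_one]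
    have := mul_le_mul_of_nonneg_left (h _ hx')
      (mul_nonneg (Real.sqrt_nonneg |x|) (abs_nonneg x))
    linarith

lemma besselBranch_mul_sphericalVec (μ : ℂ) {u x : ℝ} (hu : u ≠ 0) (hx : x ≠ 0) :
    besselBranch μ (u * x) * sphericalVec μ x / ((|x| : ℝ) : ℂ) =
      (Real.sqrt |u| : ℂ) * ((Real.pi * |u| : ℝ) : ℂ) ^ μ * (2 : ℂ) ^ (2 * μ) *
        (besselEntire (2 * μ) (-(4 * Real.pi ^ 2 * u) * x) *
          macdonald μ ((Real.pi * |x|) ^ 2)) := by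
  have hu' := abs_pos.mpr hu
  have hx' := abs_pos.mpr hx
  have hxc : ((|x| : ℝ) : ℂ) ≠ 0 := by exact_mod_cast hx'.ne'
  have hs : (Real.sqrt |x| : ℂ) * (Real.sqrt |x| : ℂ) = ((|x| : ℝ) : ℂ) := by
    rw [← Complex.ofReal_mul, Real.mul_self_sqrt hx'.le]
  have hpi2 : ((2 * Real.pi : ℝ) : ℂ) ^ (2 * μ) =
      (2 : ℂ) ^ (2 * μ) * ((Real.pi : ℂ) ^ μ * (Real.pi : ℂ) ^ μ) := by
    rw [Complex.ofReal_mul, Complex.mul_cpow_ofReal_nonneg zero_le_two Real.pi_pos.le,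
      two_mul μ, Complex.cpow_add _ _ (x := (Real.pi : ℂ)) (by exact_mod_cast Real.pi_ne_zero)]
    simp
  rw [macdonald_sq_eq μ hx', besselBranch, sphericalVec, abs_mul, Real.sqrt_mul hu'.le, hpi2,
    div_eq_iff hxc, Complex.ofReal_mul, Complex.ofReal_mul, Complex.ofReal_mul,
    Complex.ofReal_mul, Complex.ofReal_mul,
    Complex.mul_cpow_ofReal_nonneg hu'.le hx'.le,
    Complex.mul_cpow_ofReal_nonneg Real.pi_pos.le hx'.le,
    Complex.mul_cpow_ofReal_nonneg Real.pi_pos.le hu'.le, ← hs,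
    show (-(4 * (Real.pi : ℂ) ^ 2 * ((u : ℂ) * x))) = -(4 * Real.pi ^ 2 * u) * x by ring]
  ring

lemma integral_besselBranch_mul_sphericalVec {μ : ℂ} (hμ : |μ.re| < 1 / 2) {u : ℝ} (hu : u ≠ 0) :
    ∫ x : ℝ, besselBranch μ (u * x) * sphericalVec μ x / ((|x| : ℝ) : ℂ) =
      (Real.sqrt |u| : ℂ) * (((Real.pi * |u| : ℝ) : ℂ) ^ μ *
        besselEntire μ ((Real.pi * |u|) ^ 2)) := by
  have h2 : (2 : ℂ) ^ (2 * μ) * (2 : ℂ) ^ (-(2 * μ)) = 1 := by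
    rw [← Complex.cpow_add _ _ two_ne_zero]; simp
  have habs : ((|u| : ℝ) : ℂ) ^ 2 = (u : ℂ) ^ 2 := by rw [← Complex.ofReal_pow, sq_abs]; simp
  rw [integral_congr_ae (ae_ne_zero_real.mono fun x hx => besselBranch_mul_sphericalVec μ hu hx),
    integral_const_mul, integral_besselEntire_mul_macdonald hμ, mul_pow _ ((|u| : ℝ) : ℂ), habs,
    ← mul_pow]
  linear_combination (Real.sqrt |u| : ℂ) * ((Real.pi * |u| : ℝ) : ℂ) ^ μ *
    besselEntire μ ((Real.pi * u) ^ 2) * h2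

lemma integral_besselBranch_mul_sphericalVec_mul {μ : ℂ} (hμ : |μ.re| < 1 / 2) {u : ℝ}
    (hu : u ≠ 0) :
    ∫ x : ℝ, besselBranch μ (u * x) * (x * sphericalVec μ x) / ((|x| : ℝ) : ℂ) =
      -u * ((Real.sqrt |u| : ℂ) * (((Real.pi * |u| : ℝ) : ℂ) ^ μ *
        besselEntire μ ((Real.pi * |u|) ^ 2))) := by
  have h2 : (2 : ℂ) ^ (2 * μ) * (2 : ℂ) ^ (-(2 * μ)) = 1 := by
    rw [← Complex.cpow_add _ _ two_ne_zero]; simp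
  have habs : ((|u| : ℝ) : ℂ) ^ 2 = (u : ℂ) ^ 2 := by rw [← Complex.ofReal_pow, sq_abs]; simp
  have h : ∀ x : ℝ, x ≠ 0 →
      besselBranch μ (u * x) * (x * sphericalVec μ x) / ((|x| : ℝ) : ℂ) =
      (Real.sqrt |u| : ℂ) * ((Real.pi * |u| : ℝ) : ℂ) ^ μ * (2 : ℂ) ^ (2 * μ) *
        (besselEntire (2 * μ) (-(4 * Real.pi ^ 2 * u) * x) *
          (x * macdonald μ ((Real.pi * |x|) ^ 2))) := fun x hx => by
    linear_combination (x : ℂ) * besselBranch_mul_sphericalVec μ hu hx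
  rw [integral_congr_ae (ae_ne_zero_real.mono h),
    integral_const_mul, integral_besselEntire_mul_macdonald_mul hμ, mul_pow _ ((|u| : ℝ) : ℂ),
    habs, ← mul_pow]
  linear_combination (-u : ℂ) * ((Real.sqrt |u| : ℂ) * ((Real.pi * |u| : ℝ) : ℂ) ^ μ *
    besselEntire μ ((Real.pi * u) ^ 2)) * h2

lemma sin_pi_mul_ne_zero_of_abs_re_lt {ν : ℂ} (hν : |ν.re| < 1) (hν0 : ν ≠ 0) :
    Complex.sin (Real.pi * ν) ≠ 0 := by
  intro h
  rw [Complex.sin_eq_zero_iff] at h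
  obtain ⟨k, hk⟩ := h
  have hpi : (Real.pi : ℂ) ≠ 0 := by exact_mod_cast Real.pi_ne_zero
  have hk' : ν = k := by
    apply mul_left_cancel₀ hpi
    rw [hk, mul_comm]
  have h1 : |(k : ℝ)| < 1 := by simpa [hk'] using hν
  have h2 : |k| < 1 := by exact_mod_cast h1
  rw [Int.abs_lt_one_iff] at h2
  exact hν0 (by rw [hk', h2]; simp)

lemma besselTransform_eq_of_integral_besselBranch {ν : ℂ} {β : ℝ} (hν : |ν.re| < β)
    (hβ : β < 1 / 2) (hν0 : ν ≠ 0) {f : ℝ → ℂ} (hf : IsKirillovDecaying β f) {u : ℝ}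
    (hu : u ≠ 0) (c : ℂ)
    (h₁ : ∫ x : ℝ, besselBranch (-ν) (u * x) * f x / ((|x| : ℝ) : ℂ) =
      c * ((Real.sqrt |u| : ℂ) * (((Real.pi * |u| : ℝ) : ℂ) ^ (-ν) *
        besselEntire (-ν) ((Real.pi * |u|) ^ 2))))
    (h₂ : ∫ x : ℝ, besselBranch ν (u * x) * f x / ((|x| : ℝ) : ℂ) =
      c * ((Real.sqrt |u| : ℂ) * (((Real.pi * |u| : ℝ) : ℂ) ^ ν *
        besselEntire ν ((Real.pi * |u|) ^ 2)))) :
    besselTransform ν f u = c * sphericalVec ν u := by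
  have i₁ := hf.integrable_kernel (k := besselBranch (-ν)) hβ
    (fun x hx => continuousAt_besselBranch _ hx)
    (fun ε hε => exists_norm_besselBranch_le (by simpa using hν) hβ hε) hu
  have i₂ := hf.integrable_kernel (k := besselBranch ν) hβ
    (fun x hx => continuousAt_besselBranch _ hx)
    (fun ε hε => exists_norm_besselBranch_le hν hβ hε) hu
  have hν1 : |ν.re| < 1 := by linarith
  have hK := besselKInt_mul_sin hν1 hν0 (abs_pos.mpr hu)
  have hs := sin_pi_mul_ne_zero_of_abs_re_lt hν1 hν0
  have hpi : (Real.pi : ℂ) ≠ 0 := by exact_mod_cast Real.pi_ne_zero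
  have e : besselTransform ν f u = Real.pi / Complex.sin (Real.pi * ν) *
      ((∫ x : ℝ, besselBranch (-ν) (u * x) * f x / ((|x| : ℝ) : ℂ)) -
        ∫ x : ℝ, besselBranch ν (u * x) * f x / ((|x| : ℝ) : ℂ)) := by
    rw [← integral_sub i₁ i₂, ← integral_const_mul, besselTransform]
    congr 1
    ext x
    rw [besselRep_eq]
    ring
  rw [e, h₁, h₂, ← mul_sub, ← mul_sub, ← hK, sphericalVec]
  field_simp

lemma besselTransform_sphericalVec {ν : ℂ} (hν : |ν.re| < 1 / 2) (hν0 : ν ≠ 0) {u : ℝ}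
    (hu : u ≠ 0) : besselTransform ν (sphericalVec ν) u = sphericalVec ν u := by
  obtain ⟨β, h1, h2⟩ := exists_between hν
  have hβ : 0 < β := (abs_nonneg _).trans_lt h1
  have hneg : |(-ν).re| < 1 / 2 := by simpa using hν
  rw [besselTransform_eq_of_integral_besselBranch (f := sphericalVec ν) h1 h2 hν0
    (isKirillovDecaying_sqrt_mul_besselKInt hβ h1.le) hu 1, one_mul]
  · rw [one_mul, ← integral_besselBranch_mul_sphericalVec hneg hu]
    refine integral_congr_ae (ae_ne_zero_real.mono fun x hx => ?_)
    simp only [sphericalVec_neg ν hx]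
  · rw [one_mul, ← integral_besselBranch_mul_sphericalVec hν hu]

lemma besselTransform_mul_sphericalVec {ν : ℂ} (hν : |ν.re| < 1 / 2) (hν0 : ν ≠ 0) {u : ℝ}
    (hu : u ≠ 0) :
    besselTransform ν (fun x => x * sphericalVec ν x) u = -u * sphericalVec ν u := by
  obtain ⟨β, h1, h2⟩ := exists_between hν
  have hβ : 0 < β := (abs_nonneg _).trans_lt h1
  have hneg : |(-ν).re| < 1 / 2 := by simpa using hν
  rw [besselTransform_eq_of_integral_besselBranch (f := fun x => x * sphericalVec ν x)
    h1 h2 hν0 (isKirillovDecaying_sqrt_mul_besselKInt hβ h1.le).ofReal_mul hu (-u)]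
  · rw [← integral_besselBranch_mul_sphericalVec_mul hneg hu]
    refine integral_congr_ae (ae_ne_zero_real.mono fun x hx => ?_)
    simp only [sphericalVec_neg ν hx]
  · rw [← integral_besselBranch_mul_sphericalVec_mul hν hu]

/-- The Euler derivative of `sphericalVec`. -/
noncomputable def sphericalDeriv (ν : ℂ) (u : ℝ) : ℂ :=
  (Real.sqrt |u| : ℂ) * ((1 / 2 : ℂ) * besselKInt ν |u| -
    Real.pi * ((|u| : ℝ) : ℂ) * (besselKInt (ν + 1) |u| + besselKInt (ν - 1) |u|))

lemma hasDerivAt_sqrt_abs {u : ℝ} (hu : u ≠ 0) :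
    HasDerivAt (fun x : ℝ => (Real.sqrt |x| : ℂ)) ((Real.sqrt |u| : ℂ) / (2 * u)) u := by
  have h := ((hasDerivAt_abs hu).sqrt (abs_pos.mpr hu).ne').ofReal_comp
  refine h.congr_deriv ?_
  rw [← Complex.ofReal_ofNat, ← Complex.ofReal_mul, ← Complex.ofReal_div]
  congr 1
  have h1 : Real.sqrt |u| * Real.sqrt |u| = |u| := Real.mul_self_sqrt (abs_nonneg u)
  have h2 : Real.sqrt |u| ≠ 0 := (Real.sqrt_pos.mpr (abs_pos.mpr hu)).ne'
  rw [div_eq_div_iff (by positivity) (by positivity)]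
  have h3 : (SignType.sign u : ℝ) * u = |u| := sign_mul_self u
  linear_combination 2 * h3 - 2 * h1

lemma hasDerivAt_besselKInt_abs (a : ℂ) {u : ℝ} (hu : u ≠ 0) :
    HasDerivAt (fun x : ℝ => besselKInt a |x|)
      (-Real.pi * ((|u| : ℝ) : ℂ) * (besselKInt (a + 1) |u| + besselKInt (a - 1) |u|) / u) u := by
  have h := (hasDerivAt_besselKInt a (abs_pos.mpr hu)).scomp u (hasDerivAt_abs hu)
  refine h.congr_deriv ?_
  have hu' : (u : ℂ) ≠ 0 := by exact_mod_cast hu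
  have h3 : (SignType.sign u : ℝ) * u = |u| := sign_mul_self u
  rw [Complex.real_smul, ← h3, eq_div_iff hu', Complex.ofReal_mul]
  ring

lemma hasDerivAt_sphericalVec (ν : ℂ) {u : ℝ} (hu : u ≠ 0) :
    HasDerivAt (sphericalVec ν) (sphericalDeriv ν u / u) u := by
  refine ((hasDerivAt_sqrt_abs hu).mul (hasDerivAt_besselKInt_abs ν hu)).congr_deriv ?_
  have hu' : (u : ℂ) ≠ 0 := by exact_mod_cast hu
  rw [sphericalDeriv]
  field_simp
  ring

lemma hasDerivAt_sphericalDeriv (ν : ℂ) {u : ℝ} (hu : u ≠ 0) :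
    HasDerivAt (sphericalDeriv ν) ((sphericalDeriv ν u +
      ((2 * Real.pi * u) ^ 2 + ν ^ 2 - 1 / 4) * sphericalVec ν u) / u) u := by
  have hu' : (u : ℂ) ≠ 0 := by exact_mod_cast hu
  have hx := abs_pos.mpr hu
  have habs : HasDerivAt (fun x : ℝ => ((|x| : ℝ) : ℂ)) (((|u| : ℝ) : ℂ) / u) u := by
    refine (hasDerivAt_abs hu).ofReal_comp.congr_deriv ?_
    have h3 : (SignType.sign u : ℝ) * u = |u| := sign_mul_self u
    rw [← h3, eq_div_iff hu', Complex.ofReal_mul]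
  have h := (hasDerivAt_sqrt_abs hu).mul (((hasDerivAt_besselKInt_abs ν hu).const_mul
    (1 / 2 : ℂ)).sub ((habs.const_mul (Real.pi : ℂ)).mul
      ((hasDerivAt_besselKInt_abs (ν + 1) hu).add (hasDerivAt_besselKInt_abs (ν - 1) hu))))
  refine h.congr_deriv ?_
  have e0 := besselKInt_add_one_sub ν hx
  have e1 := besselKInt_add_one_sub (ν + 1) hx
  have e2 := besselKInt_add_one_sub (ν - 1) hx
  simp only [add_sub_cancel_right, sub_add_cancel] at e1 e2
  have hsq : ((|u| : ℝ) : ℂ) ^ 2 = (u : ℂ) ^ 2 := by rw [← Complex.ofReal_pow, sq_abs]; simp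
  simp only [Pi.add_apply, Pi.sub_apply, Pi.mul_apply, add_sub_cancel_right, sub_add_cancel]
  rw [sphericalDeriv, sphericalVec]
  generalize besselKInt (ν + 1 + 1) |u| = A at *
  generalize besselKInt (ν - 1 - 1) |u| = B at *
  generalize besselKInt (ν + 1) |u| = P at *
  generalize besselKInt (ν - 1) |u| = Q at *
  generalize besselKInt ν |u| = K at *
  generalize ((|u| : ℝ) : ℂ) = w at *
  generalize (Real.sqrt |u| : ℂ) = S at *
  linear_combination S * (u : ℂ)⁻¹ * (Real.pi * w * e2 - Real.pi * w * e1 - ν * e0 +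
    4 * Real.pi ^ 2 * K * hsq)

lemma isKirillovDecaying_sphericalDeriv {ν : ℂ} {β : ℝ} (hβ : 0 < β) (hν : |ν.re| ≤ β) :
    IsKirillovDecaying β (sphericalDeriv ν) := by
  have hν' := abs_le.mp hν
  have h := (((isKirillovDecaying_sqrt_mul_besselKInt hβ hν).const_mul (1 / 2)).sub
    (((isKirillovDecaying_sqrt_mul_abs_mul_besselKInt (a := ν + 1) hβ
      (by rw [abs_le]; simp; constructor <;> linarith)).add
      (isKirillovDecaying_sqrt_mul_abs_mul_besselKInt (a := ν - 1) hβ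
      (by rw [abs_le]; simp; constructor <;> linarith))).const_mul Real.pi))
  convert h using 2 with x
  rw [sphericalDeriv]
  ring

/-- A weight vector `g` with Euler derivative `e`, an eigenvector of `besselTransform`. -/
structure IsWeightPair (ν : ℂ) (β : ℝ) (L : ℕ) (g e : ℝ → ℂ) : Prop where
  decaying : IsKirillovDecaying β g
  decaying_deriv : IsKirillovDecaying β e
  hasDerivAt : ∀ u : ℝ, u ≠ 0 → HasDerivAt g (e u / u) u
  hasDerivAt_deriv : ∀ u : ℝ, u ≠ 0 → HasDerivAt e ((e u + ((2 * Real.pi * u) ^ 2 -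
    2 * L * (2 * Real.pi * u) + (ν ^ 2 - 1 / 4)) * g u) / u) u
  transform : ∀ u : ℝ, u ≠ 0 → besselTransform ν g u = (-1) ^ L * g u
  transform_mul : ∀ u : ℝ, u ≠ 0 → 2 * Real.pi * besselTransform ν (fun x => x * g x) u =
    (-1) ^ L * ((2 * L - 2 * Real.pi * u) * g u)

lemma besselTransform_of_hasDerivAt {ν : ℂ} {β : ℝ} (hν : |ν.re| < β) (hβ : β < 1 / 2)
    {f g φ ψ : ℝ → ℂ} (hf : IsKirillovDecaying β f) (hg : IsKirillovDecaying β g)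
    (hd : ∀ x, x ≠ 0 → HasDerivAt f (g x / x) x)
    (hφ : ∀ x, x ≠ 0 → besselTransform ν f x = φ x)
    (hψ : ∀ x, x ≠ 0 → HasDerivAt φ (ψ x / x) x) {u : ℝ} (hu : u ≠ 0) :
    besselTransform ν g u = -ψ u := by
  have h1 := hasDerivAt_besselTransform hν hβ hf hg hd hu
  have h2 : HasDerivAt (besselTransform ν f) (ψ u / u) u := by
    refine (hψ u hu).congr_of_eventuallyEq ?_
    filter_upwards [isOpen_ne.mem_nhds hu] with x hx using hφ x hx
  have h3 := h1.unique h2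
  have hu' : (u : ℂ) ≠ 0 := by exact_mod_cast hu
  rw [← neg_div, div_left_inj' hu'] at h3
  rw [← h3, neg_neg]

namespace IsWeightPair

variable {ν : ℂ} {β : ℝ} {L : ℕ} {g e : ℝ → ℂ}

lemma succ (hν : |ν.re| < β) (hβ : β < 1 / 2) (h : IsWeightPair ν β L g e) :
    IsWeightPair ν β (L + 1) (fun u => e u + (L - 2 * Real.pi * u) * g u)
      (fun u => (L + 1 - 2 * Real.pi * u) * e u +
        ((2 * Real.pi * u) ^ 2 - (2 * L + 1) * (2 * Real.pi * u) + (ν ^ 2 - 1 / 4)) * g u) := by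
  have hpi : (Real.pi : ℂ) ≠ 0 := by exact_mod_cast Real.pi_ne_zero
  have dg := h.decaying
  have de := h.decaying_deriv
  have dxg := dg.ofReal_mul
  have dxe := de.ofReal_mul
  have dxxg := dxg.ofReal_mul
  set σ : ℂ := (-1) ^ L with hσ
  have dh : IsKirillovDecaying β (fun x => e x + ((2 * Real.pi * x) ^ 2 -
      2 * L * (2 * Real.pi * x) + (ν ^ 2 - 1 / 4)) * g x) := by
    convert de.add (((dxxg.const_mul ((2 * Real.pi) ^ 2)).sub
      (dxg.const_mul (2 * L * (2 * Real.pi)))).add (dg.const_mul (ν ^ 2 - 1 / 4))) using 2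
    ring
  have hid : ∀ u : ℝ, HasDerivAt (fun x : ℝ => (x : ℂ)) 1 u := fun u =>
    (hasDerivAt_id u).ofReal_comp
  have te : ∀ u : ℝ, u ≠ 0 → besselTransform ν e u = -σ * e u := fun u hu => by
    rw [besselTransform_of_hasDerivAt hν hβ dg de h.hasDerivAt h.transform
      (ψ := fun x => σ * e x) (fun x hx => ?_) hu, neg_mul]
    exact ((h.hasDerivAt x hx).const_mul σ).congr_deriv (by ring)
  have th : ∀ u : ℝ, u ≠ 0 → besselTransform ν (fun x => e x + ((2 * Real.pi * x) ^ 2 -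
      2 * L * (2 * Real.pi * x) + (ν ^ 2 - 1 / 4)) * g x) u = σ * (e u +
        ((2 * Real.pi * u) ^ 2 - 2 * L * (2 * Real.pi * u) + (ν ^ 2 - 1 / 4)) * g u) :=
    fun u hu => by
    rw [besselTransform_of_hasDerivAt hν hβ de dh h.hasDerivAt_deriv te
      (ψ := fun x => -σ * (e x + ((2 * Real.pi * x) ^ 2 -
        2 * L * (2 * Real.pi * x) + (ν ^ 2 - 1 / 4)) * g x)) (fun x hx => ?_) hu]
    · ring
    · exact ((h.hasDerivAt_deriv x hx).const_mul (-σ)).congr_deriv (by ring)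
  have txe : ∀ u : ℝ, u ≠ 0 → 2 * Real.pi * besselTransform ν (fun x => x * g x + x * e x) u =
      -σ * ((2 * L - 2 * Real.pi * u) * e u - 2 * Real.pi * u * g u) := fun u hu => by
    rw [besselTransform_of_hasDerivAt hν hβ dxg (dxg.add dxe)
      (φ := fun x => σ * ((L / Real.pi - x) * g x))
      (ψ := fun x => σ * ((L / Real.pi - x) * e x - x * g x)) (fun x hx => ?_) (fun x hx => ?_)
      (fun x hx => ?_) hu]
    · field_simp
    · refine ((hid x).mul (h.hasDerivAt x hx)).congr_deriv ?_
      have hx' : (x : ℂ) ≠ 0 := by exact_mod_cast hx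
      field_simp
    · have := h.transform_mul x hx
      field_simp
      linear_combination this / 2
    · refine ((((hasDerivAt_const x (L / Real.pi : ℂ)).sub (hid x)).mul
        (h.hasDerivAt x hx)).const_mul σ).congr_deriv ?_
      have hx' : (x : ℂ) ≠ 0 := by exact_mod_cast hx
      simp only [Pi.sub_apply]
      field_simp
      ring
  refine ⟨?_, ?_, fun u hu => ?_, fun u hu => ?_, fun u hu => ?_, fun u hu => ?_⟩
  · convert de.add ((dg.const_mul L).sub (dxg.const_mul (2 * Real.pi))) using 2
    ring
  · convert ((de.const_mul (L + 1)).sub (dxe.const_mul (2 * Real.pi))).add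
      (((dxxg.const_mul ((2 * Real.pi) ^ 2)).sub
      (dxg.const_mul ((2 * L + 1) * (2 * Real.pi)))).add (dg.const_mul (ν ^ 2 - 1 / 4))) using 2
    ring
  · have hu' : (u : ℂ) ≠ 0 := by exact_mod_cast hu
    refine ((h.hasDerivAt_deriv u hu).add (((hasDerivAt_const u (L : ℂ)).sub
      ((hid u).const_mul (2 * Real.pi : ℂ))).mul (h.hasDerivAt u hu))).congr_deriv ?_
    simp only [Pi.sub_apply]
    field_simp
    ring
  · have hu' : (u : ℂ) ≠ 0 := by exact_mod_cast hu
    have hq := (hid u).const_mul (2 * Real.pi : ℂ)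
    refine ((((hasDerivAt_const u (L + 1 : ℂ)).sub hq).mul (h.hasDerivAt_deriv u hu)).add
      ((((hq.pow 2).sub (hq.const_mul (2 * L + 1 : ℂ))).add
        (hasDerivAt_const u (ν ^ 2 - 1 / 4))).mul (h.hasDerivAt u hu))).congr_deriv ?_
    simp only [Pi.sub_apply, Pi.add_apply, Pi.pow_apply]
    push_cast
    field_simp
    ring
  · have e1 : ∀ x : ℝ, x ≠ 0 → e x + (L - 2 * Real.pi * x) * g x =
        e x + (L * g x + (-(2 * Real.pi)) * (x * g x)) := fun x _ => by ring
    rw [besselTransform_congr e1, besselTransform_add hν hβ de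
      ((dg.const_mul _).add (dxg.const_mul _)) hu,
      besselTransform_add hν hβ (dg.const_mul _) (dxg.const_mul _) hu,
      besselTransform_const_mul, besselTransform_const_mul, te u hu, h.transform u hu, pow_succ]
    linear_combination -h.transform_mul u hu
  · have e1 : ∀ x : ℝ, x ≠ 0 → x * (e x + (L - 2 * Real.pi * x) * g x) =
        (x * g x + x * e x) + (-(L + 1) * (x * g x) + (-(2 * (Real.pi : ℂ)))⁻¹ *
        ((e x + ((2 * Real.pi * x) ^ 2 - 2 * L * (2 * Real.pi * x) + (ν ^ 2 - 1 / 4)) * g x) +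
          (-1 * e x + -(ν ^ 2 - 1 / 4) * g x))) := fun x _ => by
      field_simp
      ring
    have d1 := (de.const_mul (-1)).add (dg.const_mul (-(ν ^ 2 - 1 / 4)))
    rw [besselTransform_congr e1, besselTransform_add hν hβ (dxg.add dxe)
      ((dxg.const_mul _).add ((dh.add d1).const_mul _)) hu,
      besselTransform_add hν hβ (dxg.const_mul _) ((dh.add d1).const_mul _) hu,
      besselTransform_const_mul, besselTransform_const_mul,
      besselTransform_add hν hβ dh d1 hu,
      besselTransform_add hν hβ (de.const_mul _) (dg.const_mul _) hu,
      besselTransform_const_mul, besselTransform_const_mul,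
      te u hu, h.transform u hu, th u hu, pow_succ, mul_add, mul_add, txe u hu,
      mul_left_comm _ (-((L : ℂ) + 1)), h.transform_mul u hu]
    push_cast
    field_simp
    ring

lemma zero (hβ0 : 0 < β) (hν : |ν.re| < β) (hβ : β < 1 / 2) (hν0 : ν ≠ 0) (a : ℂ) :
    IsWeightPair ν β 0 (fun u => a * sphericalVec ν u) (fun u => a * sphericalDeriv ν u) := by
  have hν2 := hν.trans hβ
  refine ⟨(isKirillovDecaying_sqrt_mul_besselKInt hβ0 hν.le).const_mul a,
    (isKirillovDecaying_sphericalDeriv hβ0 hν.le).const_mul a, fun u hu => ?_, fun u hu => ?_,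
    fun u hu => ?_, fun u hu => ?_⟩
  · exact ((hasDerivAt_sphericalVec ν hu).const_mul a).congr_deriv (by ring)
  · exact ((hasDerivAt_sphericalDeriv ν hu).const_mul a).congr_deriv (by push_cast; ring)
  · rw [besselTransform_const_mul, besselTransform_sphericalVec hν2 hν0 hu]
    simp
  · simp only [mul_left_comm _ a]
    rw [besselTransform_const_mul, besselTransform_mul_sphericalVec hν2 hν0 hu]
    push_cast
    ring

end IsWeightPair

lemma exists_isWeightPair_eq_kirillovSum {ν : ℂ} {β : ℝ} (hβ0 : 0 < β) (hν : |ν.re| < β)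
    (hβ : β < 1 / 2) (hν0 : ν ≠ 0) (L : ℕ) :
    ∃ g e, IsWeightPair ν β L g e ∧ ∀ u, u ≠ 0 → g u = kirillovSum ν L u := by
  induction L with
  | zero =>
    refine ⟨_, _, IsWeightPair.zero hβ0 hν hβ hν0 (kirillovCoeff 0 0), fun u hu => ?_⟩
    simp [kirillovSum, kirillovInt_zero, sphericalVec]
    ring
  | succ L ih =>
    obtain ⟨g, e, h, hg⟩ := ih
    refine ⟨_, _, h.succ hν hβ, fun u hu => ?_⟩
    have h1 : HasDerivAt g _ u := (hasDerivAt_kirillovSum ν L hu).congr_of_eventuallyEq (by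
      filter_upwards [isOpen_ne.mem_nhds hu] with x hx using hg x hx)
    have h2 := (h.hasDerivAt u hu).unique h1
    have hu' : (u : ℂ) ≠ 0 := by exact_mod_cast hu
    rw [div_left_inj' hu'] at h2
    rw [h2, hg u hu]
    ring

lemma besselTransform_kirillovSum {ν : ℂ} (hν : |ν.re| < 1 / 2) (hν0 : ν ≠ 0) (L : ℕ) {u : ℝ}
    (hu : u ≠ 0) :
    Integrable (fun x : ℝ => besselRep ν (u * x) * kirillovSum ν L x / ((|x| : ℝ) : ℂ)) ∧
      ∫ x : ℝ, besselRep ν (u * x) * kirillovSum ν L x / ((|x| : ℝ) : ℂ) =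
        (-1) ^ L * kirillovSum ν L u := by
  obtain ⟨β, h1, h2⟩ := exists_between hν
  obtain ⟨g, e, h, hg⟩ := exists_isWeightPair_eq_kirillovSum ((abs_nonneg _).trans_lt h1) h1 h2
    hν0 L
  refine ⟨(h.decaying.integrable h1 h2 hu).congr ?_, ?_⟩
  · filter_upwards [ae_ne_zero_real] with x hx
    rw [hg x hx]
  · have := besselTransform_congr (ν := ν) hg u
    rw [h.transform u hu, hg u hu] at this
    exact this.symm

lemma Kvec_eq_kirillovSum (ℓ : ℤ) (ν : ℂ) {u s : ℝ} (hu : u ≠ 0) (hs : s = 1 ∨ s = -1)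
    (hℓ : (ℓ.natAbs : ℝ) * s = ℓ) :
    Kvec ℓ ν u = (Real.pi : ℂ) ^ ν / Complex.Gamma (ν + (ℓ.natAbs : ℂ) + 1 / 2) *
      kirillovSum ν ℓ.natAbs (u * s) := by
  have hu' := abs_pos.mpr hu
  have hsabs : |u * s| = |u| := by rcases hs with rfl | rfl <;> simp
  rw [Kvec, kirillovSum, Finset.mul_sum (Finset.range _) _ (Real.sqrt |u * s| : ℂ), hsabs]
  congr 1
  refine Finset.sum_congr rfl fun j hj => ?_
  have hpow : ((|u| : ℝ) : ℂ) ^ ((j : ℂ) + 1 / 2) =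
      (Real.sqrt |u| : ℂ) * ((|u| : ℝ) : ℂ) ^ j := by
    rw [Complex.cpow_add _ _ (by exact_mod_cast hu'.ne'), Complex.cpow_natCast, mul_comm,
      Real.sqrt_eq_rpow, Complex.ofReal_cpow hu'.le]
    simp
  have hint : (∫ t in Set.Ioi (0 : ℝ), (t : ℂ) ^ (ν - 1) *
      (((Real.sqrt t + Real.sign (u * (ℓ : ℝ)) / Real.sqrt t) ^ (2 * j) : ℝ) : ℂ) *
      (Real.exp (-(Real.pi * |u| * (t + 1 / t))) : ℂ)) =
      kirillovInt ν (Real.sign (u * s)) j |u| := by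
    refine setIntegral_congr_fun measurableSet_Ioi fun t ht => ?_
    have ht' : (0 : ℝ) < t := ht
    have hst : 0 < Real.sqrt t := Real.sqrt_pos.mpr ht'
    have key : (Real.sqrt t + Real.sign (u * (ℓ : ℝ)) / Real.sqrt t) ^ (2 * j) =
        (t + 1 / t + 2 * Real.sign (u * s)) ^ j := by
      rcases Nat.eq_zero_or_pos ℓ.natAbs with h0 | h0
      · have : j = 0 := by rw [h0] at hj; simpa using hj
        simp [this]
      · have hn : (0 : ℝ) < ℓ.natAbs := by exact_mod_cast h0
        have hsgn : Real.sign (u * (ℓ : ℝ)) = Real.sign (u * s) := by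
          rw [← hℓ, mul_left_comm]
          rcases lt_trichotomy (u * s) 0 with h | h | h
          · rw [Real.sign_of_neg h, Real.sign_of_neg (mul_neg_of_pos_of_neg hn h)]
          · rw [h, mul_zero]
          · rw [Real.sign_of_pos h, Real.sign_of_pos (mul_pos hn h)]
        have hus : u * s ≠ 0 := by rcases hs with rfl | rfl <;> simpa using hu
        have h1 : Real.sign (u * s) ^ 2 = 1 := by
          rcases Real.sign_apply_eq_of_ne_zero _ hus with h | h <;> rw [h] <;> norm_num
        have h2 : Real.sqrt t ^ 2 = t := Real.sq_sqrt ht'.le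
        rw [pow_mul, hsgn]
        congr 1
        have : (Real.sqrt t + Real.sign (u * s) / Real.sqrt t) ^ 2 =
          Real.sqrt t ^ 2 + Real.sign (u * s) ^ 2 / Real.sqrt t ^ 2 +
            2 * Real.sign (u * s) := by
          field_simp
          ring
        rw [this, h1, h2]
    simp only [key]
  rw [hpow, hint, kirillovCoeff]
  ring

/-- Bessel transform identity for Kirillov vectors (action of the Weyl element). -/
theorem kirillov_bessel_transform (ν : ℂ) (hν : |ν.re| < 1 / 2) (hν0 : ν ≠ 0)
    (ℓ : ℤ) (u : ℝ) (hu : u ≠ 0) :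
    IntegrableOn (fun lam : ℝ => besselRep ν (u * lam) * Kvec ℓ ν lam / ((|lam| : ℝ) : ℂ))
      {(0 : ℝ)}ᶜ ∧
    (-1 : ℂ) ^ ℓ * Kvec ℓ ν u =
      ∫ lam in ({(0 : ℝ)}ᶜ : Set ℝ),
        besselRep ν (u * lam) * Kvec ℓ ν lam / ((|lam| : ℝ) : ℂ) := by
  obtain ⟨s, hs, hℓ, hpow⟩ : ∃ s : ℝ, (s = 1 ∨ s = -1) ∧ (ℓ.natAbs : ℝ) * s = ℓ ∧
      (-1 : ℂ) ^ ℓ = (-1) ^ ℓ.natAbs := by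
    obtain ⟨n, rfl | rfl⟩ := ℓ.eq_nat_or_neg
    · exact ⟨1, by simp⟩
    · exact ⟨-1, by simp [← inv_pow]⟩
  have hs1 : s * s = 1 := by rcases hs with rfl | rfl <;> norm_num
  have hs0 : s ≠ 0 := left_ne_zero_of_mul_eq_one hs1
  have hsabs : |s| = 1 := by rcases hs with rfl | rfl <;> simp
  set c : ℂ := (Real.pi : ℂ) ^ ν / Complex.Gamma (ν + (ℓ.natAbs : ℂ) + 1 / 2) with hc
  obtain ⟨hint, heq⟩ := besselTransform_kirillovSum hν hν0 ℓ.natAbs (mul_ne_zero hu hs0)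
  set F : ℝ → ℂ := fun x =>
    besselRep ν (u * s * x) * kirillovSum ν ℓ.natAbs x / ((|x| : ℝ) : ℂ) with hF
  have hae : ∀ᵐ x : ℝ, c * F (s * x) =
      besselRep ν (u * x) * Kvec ℓ ν x / ((|x| : ℝ) : ℂ) := by
    filter_upwards [ae_ne_zero_real] with x hx
    rw [Kvec_eq_kirillovSum ℓ ν hx hs hℓ, hF]
    simp only
    rw [abs_mul, hsabs, one_mul, show u * s * (s * x) = u * x by
      rw [mul_assoc, ← mul_assoc s, hs1, one_mul], mul_comm s x]
    ring
  rw [IntegrableOn, restrict_compl_singleton]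
  refine ⟨((hint.comp_mul_left' hs0).const_mul c).congr hae, ?_⟩
  rw [← integral_congr_ae hae, integral_const_mul, Measure.integral_comp_mul_left, heq, hpow,
    Kvec_eq_kirillovSum ℓ ν hu hs hℓ, abs_inv, hsabs, inv_one, one_smul, mul_left_comm]
end

section
/- Elliptic orbital integral in terms of the digamma function: let m ≥ 2 and 1 ≤ j ≤ m−1 be integers, and let α > 1 be real. Then ∫_{−∞}^{∞} e^{−2πjt/m} / ( ((α−1/2)² + t²) · (1 + e^{−2πt}) ) dt = (2/((1−2α)·m)) · Σ_{l=0}^{m−1} sin((2l+1)·jπ/m) · ψ((α+l)/m), where ψ(x) = Γ′(x)/Γ(x) is the digamma function (the logarithmic derivative of the real Gamma function) and the integral converges absolutely. -/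
open MeasureTheory

open Set Filter Topology in
/-- The two-sided Laplace transform of the logistic function. -/
theorem integrable_and_integral_cexp_div_one_add_cexp {u : ℂ} (hu0 : 0 < u.re) (hu1 : u.re < 1) :
    Integrable (fun y : ℝ => Complex.exp (u * y) / (1 + Complex.exp y)) ∧
      ∫ y : ℝ, Complex.exp (u * y) / (1 + Complex.exp y) =
        Real.pi / Complex.sin (Real.pi * u) := by
  have hv : 0 < (1 - u).re := by simpa using hu1
  set g : ℝ → ℂ := fun x => (x : ℂ) ^ (u - 1) * (1 - (x : ℂ)) ^ (1 - u - 1) with hg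
  have himg : Real.sigmoid '' univ = Ioo 0 1 := by rw [image_univ, Real.range_sigmoid]
  have hderiv : ∀ x ∈ (univ : Set ℝ), HasDerivWithinAt Real.sigmoid
      (Real.sigmoid x * (1 - Real.sigmoid x)) univ x :=
    fun x _ => (Real.hasDerivAt_sigmoid x).hasDerivWithinAt
  have hcomp : (fun y : ℝ => |Real.sigmoid y * (1 - Real.sigmoid y)| • g (Real.sigmoid y)) =
      fun y : ℝ => Complex.exp (u * y) / (1 + Complex.exp y) := by
    funext y
    have h0 := Real.sigmoid_pos y
    have h1 := Real.sigmoid_lt_one y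
    have hσ : (Real.sigmoid y : ℂ) ≠ 0 := Complex.ofReal_ne_zero.2 h0.ne'
    have hsub : 1 - Real.sigmoid y = Real.exp (-y) * Real.sigmoid y := by
      rw [← Real.sigmoid_neg, ← Real.sigmoid_mul_rexp_neg, mul_comm]
    have hpow : (Real.exp (-y) : ℂ) ^ (1 - u - 1) = Complex.exp (u * y) := by
      rw [Complex.cpow_def_of_ne_zero (Complex.ofReal_ne_zero.2 (Real.exp_pos _).ne'),
        ← Complex.ofReal_log (Real.exp_pos _).le, Real.log_exp]
      congr 1
      push_cast
      ring
    have hone : (1 : ℂ) - (Real.sigmoid y : ℂ) = (Real.exp (-y) : ℂ) * (Real.sigmoid y : ℂ) := by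
      exact_mod_cast hsub
    have hmul : (Real.sigmoid y : ℂ) ^ (u - 1) * (Real.sigmoid y : ℂ) ^ (1 - u - 1) =
        (Real.sigmoid y : ℂ)⁻¹ := by
      rw [← Complex.cpow_add _ _ hσ, show u - 1 + (1 - u - 1) = -1 by ring, Complex.cpow_neg_one]
    have hlast : (1 : ℂ) - (Real.sigmoid y : ℂ) = 1 / (1 + Complex.exp y) := by
      have : 1 - Real.sigmoid y = 1 / (1 + Real.exp y) := by
        rw [← Real.sigmoid_neg, Real.sigmoid_def, neg_neg, one_div]
      exact_mod_cast this
    have hval : g (Real.sigmoid y) = Complex.exp (u * y) * (Real.sigmoid y : ℂ)⁻¹ := by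
      rw [← hpow, ← hmul]
      simp only [hg]
      rw [hone, Complex.mul_cpow_ofReal_nonneg (Real.exp_pos _).le h0.le]
      ring
    rw [abs_of_pos (mul_pos h0 (by linarith)), hval, Complex.real_smul]
    push_cast
    rw [hlast]
    field_simp
  constructor
  · have h := (intervalIntegrable_iff_integrableOn_Ioo_of_le zero_le_one).1
      (Complex.betaIntegral_convergent hu0 hv)
    rw [← himg, integrableOn_image_iff_integrableOn_abs_deriv_smul MeasurableSet.univ hderiv
      Real.sigmoid_injective.injOn, integrableOn_univ] at h
    rwa [← hcomp]
  · have h := integral_image_eq_integral_abs_deriv_smul MeasurableSet.univ hderiv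
      Real.sigmoid_injective.injOn g
    rw [hcomp, himg, Measure.restrict_univ, ← integral_Ioc_eq_integral_Ioo,
      ← intervalIntegral.integral_of_le zero_le_one] at h
    rw [← h, ← Complex.Gamma_mul_Gamma_one_sub, Complex.Gamma_mul_Gamma_eq_betaIntegral hu0 hv,
      add_sub_cancel, Complex.Gamma_one, one_mul, Complex.betaIntegral]

open Set Filter Topology in
/-- Euler's limit formula for the digamma function on the positive real axis. -/
theorem tendsto_sum_inv_sub_log {x : ℝ} (hx : 0 < x) :
    Tendsto (fun n : ℕ => ∑ k ∈ Finset.range n, 1 / (x + k) - Real.log n) atTop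
      (𝓝 (-(deriv Real.Gamma x / Real.Gamma x))) := by
  set f : ℝ → ℝ := Real.log ∘ Real.Gamma with hf
  have hc : ConvexOn ℝ (Ioi 0) f := Real.convexOn_log_Gamma
  have hne {y : ℝ} (hy : 0 < y) (n : ℕ) : y ≠ -n :=
    ne_of_gt (lt_of_le_of_lt (neg_nonpos.2 n.cast_nonneg) hy)
  have hrec (y : ℝ) (hy : 0 < y) : f (y + 1) = f y + Real.log y := by
    simp only [f, Function.comp_apply, Real.Gamma_add_one hy.ne',
      Real.log_mul hy.ne' (Real.Gamma_pos_of_pos hy).ne', add_comm]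
  have hder {y : ℝ} (hy : 0 < y) : DifferentiableAt ℝ f y :=
    (Real.differentiableAt_Gamma (hne hy)).log (Real.Gamma_ne_zero (hne hy))
  have hlog : deriv f x = deriv Real.Gamma x / Real.Gamma x := by
    rw [hf, Function.comp_def, deriv.log (Real.differentiableAt_Gamma (hne hx))
      (Real.Gamma_ne_zero (hne hx))]
  have hder_rec (y : ℝ) (hy : 0 < y) : deriv f (y + 1) = deriv f y + 1 / y := by
    rw [← deriv_comp_add_const, one_div, ← Real.deriv_log,
      ← deriv_add (hder hy) (Real.differentiableAt_log hy.ne')]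
    apply EventuallyEq.deriv_eq
    filter_upwards [eventually_gt_nhds hy] using hrec
  have hder_nat (n : ℕ) : deriv f (x + n) = deriv f x + ∑ k ∈ Finset.range n, 1 / (x + k) := by
    induction n with
    | zero => simp
    | succ n hn =>
      rw [Finset.sum_range_succ, ← add_assoc, ← hn, ← hder_rec _ (by positivity)]
      push_cast
      ring_nf
  have hub (n : ℕ) : deriv f (x + n) ≤ Real.log (n + x) := by
    have hp : 0 < x + n := by positivity
    refine (hc.deriv_le_slope (mem_Ioi.2 hp) (mem_Ioi.2 (add_pos hp one_pos)) (by linarith)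
      (hder hp)).trans (le_of_eq ?_)
    rw [slope_def_field, hrec _ hp, add_comm x]
    simp
  have hlb (n : ℕ) (hn : 1 ≤ n) : Real.log (n + (x - 1)) ≤ deriv f (x + n) := by
    have hn' : (1 : ℝ) ≤ n := by exact_mod_cast hn
    have hp : 0 < n + (x - 1) := by linarith
    have hq : n + (x - 1) + 1 = x + n := by ring
    have := hc.slope_le_deriv (mem_Ioi.2 hp) (mem_Ioi.2 (add_pos hp one_pos)) (by linarith)
      (hder (by linarith))
    rw [slope_def_field, hrec _ hp, hq] at this
    refine (le_of_eq ?_).trans this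
    rw [← hq]
    simp
  have hlim (a : ℝ) : Tendsto (fun n : ℕ => Real.log (n + a) - Real.log n) atTop (𝓝 0) := by
    simpa using! (Real.tendsto_log_comp_add_sub_log a).comp tendsto_natCast_atTop_atTop
  have hmain : Tendsto (fun n : ℕ => deriv f (x + n) - Real.log n) atTop (𝓝 0) := by
    refine tendsto_of_tendsto_of_tendsto_of_le_of_le' (hlim (x - 1)) (hlim x) ?_ ?_
    · filter_upwards [eventually_ge_atTop 1] with n hn
      exact sub_le_sub_right (hlb n hn) _
    · exact Eventually.of_forall fun n => sub_le_sub_right (hub n) _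
  rw [← hlog, ← zero_sub]
  refine (hmain.sub_const _).congr fun n => ?_
  rw [hder_nat]
  ring

/-- The cosine transform of the logistic-type weight `exp (-2πct) / (1 + exp (-2πt))`. -/
theorem integrable_and_integral_exp_div_one_add_exp_mul_cos {c : ℝ} (hc0 : 0 < c) (hc1 : c < 1)
    (x : ℝ) :
    Integrable (fun t : ℝ => Real.exp (-2 * Real.pi * c * t) / (1 + Real.exp (-2 * Real.pi * t)) *
      Real.cos (x * t)) ∧
    ∫ t : ℝ, Real.exp (-2 * Real.pi * c * t) / (1 + Real.exp (-2 * Real.pi * t)) *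
      Real.cos (x * t) = (1 / (2 * Complex.sin (Real.pi * c + x / 2 * Complex.I))).re := by
  have hπ := Real.pi_pos
  have hπ' : (Real.pi : ℂ) ≠ 0 := Complex.ofReal_ne_zero.2 hπ.ne'
  set u : ℂ := c + (x / (2 * Real.pi) : ℝ) * Complex.I with hu
  have hre : u.re = c := by
    rw [hu, Complex.add_re, Complex.ofReal_re, Complex.re_ofReal_mul, Complex.I_re, mul_zero,
      add_zero]
  obtain ⟨hint, hval⟩ := integrable_and_integral_cexp_div_one_add_cexp (u := u) (by rwa [hre])
    (by rwa [hre])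
  have ha : (-2 * Real.pi) ≠ 0 := by simp [hπ.ne']
  have hpt (t : ℝ) : Complex.exp (u * (-2 * Real.pi * t : ℝ)) /
      (1 + Complex.exp (-2 * Real.pi * t : ℝ)) =
      (Real.exp (-2 * Real.pi * c * t) / (1 + Real.exp (-2 * Real.pi * t)) : ℝ) *
        Complex.exp ((-(x * t) : ℝ) * Complex.I) := by
    have : u * (-2 * Real.pi * t : ℝ) =
        (-2 * Real.pi * c * t : ℝ) + (-(x * t) : ℝ) * Complex.I := by
      simp only [hu]
      push_cast
      field_simp
      ring
    rw [this, Complex.exp_add]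
    push_cast
    ring
  have hptre (t : ℝ) : (Complex.exp (u * (-2 * Real.pi * t : ℝ)) /
      (1 + Complex.exp (-2 * Real.pi * t : ℝ))).re =
      Real.exp (-2 * Real.pi * c * t) / (1 + Real.exp (-2 * Real.pi * t)) * Real.cos (x * t) := by
    rw [hpt, Complex.re_ofReal_mul, Complex.exp_ofReal_mul_I_re, Real.cos_neg]
  have hint' := hint.comp_mul_left' ha
  have hval' := Measure.integral_comp_mul_left
    (fun y : ℝ => Complex.exp (u * y) / (1 + Complex.exp y)) (-2 * Real.pi)
  simp_rw [← hptre]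
  refine ⟨hint'.re, ?_⟩
  refine (integral_re hint').trans ?_
  rw [hval', hval]
  have habs : |(-2 * Real.pi)⁻¹| = (2 * Real.pi)⁻¹ := by
    rw [abs_inv, abs_mul, abs_neg, abs_two, abs_of_pos hπ]
  have harg : (Real.pi : ℂ) * u = Real.pi * c + x / 2 * Complex.I := by
    simp only [hu]
    push_cast
    field_simp
  rw [habs, harg, Complex.real_smul]
  change Complex.re _ = _
  congr 1
  push_cast
  rw [mul_inv, one_div, mul_inv]
  field_simp

/-- Real part of the cosecant along a vertical line through a rational multiple of `π`, as a
finite exponential sum. -/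
theorem re_one_div_two_mul_sin {m j : ℕ} (hm : 0 < m) {x : ℝ} (hx : 0 < x) :
    (1 / (2 * Complex.sin (Real.pi * (j / m : ℝ) + x / 2 * Complex.I))).re =
      (∑ l ∈ Finset.range m, Real.sin ((2 * l + 1) * j * Real.pi / m) *
        Real.exp (-((l + 1 / 2) * x))) / (1 - Real.exp (-(m * x))) := by
  have hm0 : (m : ℝ) ≠ 0 := by positivity
  have hm1 : (m : ℂ) ≠ 0 := by exact_mod_cast hm.ne'
  set w : ℂ := Real.pi * (j / m : ℝ) + x / 2 * Complex.I with hw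
  set p : ℂ := Complex.exp (w * Complex.I) with hp
  have hp0 : p ≠ 0 := Complex.exp_ne_zero _
  have hpow (l : ℕ) : p ^ (2 * l + 1) = Real.exp (-((l + 1 / 2) * x)) *
      Complex.exp (((2 * l + 1) * j * Real.pi / m : ℝ) * Complex.I) := by
    rw [hp, ← Complex.exp_nat_mul, Complex.ofReal_exp, ← Complex.exp_add]
    congr 1
    simp only [hw]
    push_cast
    linear_combination ((2 * l + 1) * x / 2 : ℂ) * Complex.I_sq
  have hpm : p ^ (2 * m) = (Real.exp (-(m * x)) : ℝ) := by
    rw [hp, ← Complex.exp_nat_mul, Complex.ofReal_exp]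
    have : ((2 * m : ℕ) : ℂ) * (w * Complex.I) =
        ((-(m * x) : ℝ) : ℂ) + (j : ℤ) * (2 * Real.pi * Complex.I) := by
      simp only [hw]
      push_cast
      field_simp
      linear_combination (m * x : ℂ) * Complex.I_sq
    rw [this, Complex.exp_add, Complex.exp_int_mul_two_pi_mul_I, mul_one]
  have hD : 0 < 1 - Real.exp (-(m * x)) := by
    rw [sub_pos, Real.exp_lt_one_iff, neg_lt_zero]
    positivity
  have hgeom : (∑ l ∈ Finset.range m, p ^ (2 * l)) * (p ^ 2 - 1) = p ^ (2 * m) - 1 := by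
    simp_rw [pow_mul]
    exact geom_sum_mul _ _
  have hD' : p ^ (2 * m) - 1 ≠ 0 := by
    rw [hpm]
    intro h
    have : Real.exp (-(m * x)) - 1 = 0 := by exact_mod_cast h
    linarith
  have hp2 : p ^ 2 - 1 ≠ 0 := fun h => hD' (by rw [← hgeom, h, mul_zero])
  have hsin : 2 * Complex.sin w = (p⁻¹ - p) * Complex.I := by
    rw [Complex.two_sin, neg_mul, Complex.exp_neg]
  have hmain : 1 / (2 * Complex.sin w) =
      (((1 - Real.exp (-(m * x)))⁻¹ : ℝ) : ℂ) *
        (-Complex.I * ∑ l ∈ Finset.range m, p ^ (2 * l + 1)) := by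
    have h1 : ∑ l ∈ Finset.range m, p ^ (2 * l + 1) =
        p * ∑ l ∈ Finset.range m, p ^ (2 * l) := by
      rw [Finset.mul_sum]
      exact Finset.sum_congr rfl fun l _ => by ring
    have h2 : ((1 - Real.exp (-(m * x)) : ℝ) : ℂ) = -(p ^ (2 * m) - 1) := by
      rw [hpm]
      push_cast
      ring
    have h3 : p⁻¹ - p ≠ 0 := by
      intro h
      apply hp2
      have : p * (p⁻¹ - p) = 0 := by rw [h, mul_zero]
      rw [mul_sub, mul_inv_cancel₀ hp0] at this
      linear_combination -this
    rw [hsin, h1, Complex.ofReal_inv, h2, ← hgeom, eq_comm, eq_div_iff (by simp [h3])]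
    have h4 : (∑ l ∈ Finset.range m, p ^ (2 * l)) ≠ 0 := by
      intro h
      apply hD'
      rw [← hgeom, h, zero_mul]
    field_simp
    rw [Complex.I_sq]
    ring
  rw [hmain, Complex.re_ofReal_mul, div_eq_inv_mul]
  congr 1
  have hre (z : ℂ) : (-Complex.I * z).re = z.im := by simp
  rw [hre, Complex.im_sum]
  refine Finset.sum_congr rfl fun l _ => ?_
  rw [hpow, Complex.im_ofReal_mul, Complex.exp_ofReal_mul_I_im, mul_comm]

/-- The sum of `sin` over the odd multiples of `jπ/m` vanishes when `m ∤ j`. -/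
theorem sum_sin_odd_mul_eq_zero {m j : ℕ} (hj0 : 0 < j) (hjm : j < m) :
    ∑ l ∈ Finset.range m, Real.sin ((2 * l + 1) * j * Real.pi / m) = 0 := by
  have hm : (0 : ℝ) < m := by exact_mod_cast hj0.trans hjm
  have hs : Real.sin (j * Real.pi / m) ≠ 0 := by
    apply ne_of_gt
    apply Real.sin_pos_of_pos_of_lt_pi
    · positivity
    · rw [div_lt_iff₀ hm, mul_comm]
      exact mul_lt_mul_of_pos_left (by exact_mod_cast hjm) Real.pi_pos
  have key : ∀ n : ℕ, 2 * Real.sin (j * Real.pi / m) *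
      ∑ l ∈ Finset.range n, Real.sin ((2 * l + 1) * j * Real.pi / m) =
      1 - Real.cos (2 * n * (j * Real.pi / m)) := by
    intro n
    induction n with
    | zero => simp
    | succ n ih =>
      rw [Finset.sum_range_succ, mul_add, ih]
      have h1 : (2 * (n : ℝ) + 1) * j * Real.pi / m =
          2 * n * (j * Real.pi / m) + j * Real.pi / m := by ring
      have h2 : 2 * ((n + 1 : ℕ) : ℝ) * (j * Real.pi / m) =
          (2 * n * (j * Real.pi / m) + j * Real.pi / m) + j * Real.pi / m := by
        push_cast
        ring
      have h3 : 2 * (n : ℝ) * (j * Real.pi / m) =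
          (2 * n * (j * Real.pi / m) + j * Real.pi / m) - j * Real.pi / m := by ring
      rw [h1, h2, Real.cos_add]
      nth_rewrite 1 [h3]
      rw [Real.cos_sub]
      ring
  have h := key m
  have hcos : 2 * (m : ℝ) * (j * Real.pi / m) = j * (2 * Real.pi) := by field_simp
  rw [hcos, Real.cos_nat_mul_two_pi, sub_self] at h
  exact (mul_eq_zero.1 h).resolve_left (by simp [hs])

open Set in
/-- The Laplace transform of the cosine. -/
theorem integral_exp_neg_mul_cos_Ioi {b : ℝ} (hb : 0 < b) (t : ℝ) :
    ∫ x in Ioi (0 : ℝ), Real.exp (-(b * x)) * Real.cos (x * t) = b / (b ^ 2 + t ^ 2) := by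
  have hre : (-b + t * Complex.I : ℂ).re < 0 := by simpa using hb
  have hpt (x : ℝ) : (Complex.exp ((-b + t * Complex.I) * x)).re =
      Real.exp (-(b * x)) * Real.cos (x * t) := by
    rw [show (-b + t * Complex.I : ℂ) * x = (-(b * x) : ℝ) + (x * t : ℝ) * Complex.I by
      push_cast; ring, Complex.exp_add, ← Complex.ofReal_exp, Complex.re_ofReal_mul,
      Complex.exp_ofReal_mul_I_re]
  simp_rw [← hpt]
  refine (integral_re (integrableOn_exp_mul_complex_Ioi hre 0)).trans ?_
  rw [integral_exp_mul_complex_Ioi hre 0]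
  change Complex.re _ = _
  simp [Complex.div_re, Complex.normSq_apply]
  ring

open Set in
/-- Termwise integration of an exponential sum against the geometric series of `exp (-mx)`. -/
theorem hasSum_sum_div_of_sum_eq_zero {m : ℕ} (hm : 0 < m) {a : ℝ} (ha : 0 < a) {s : ℕ → ℝ}
    (hs : ∑ l ∈ Finset.range m, s l = 0) :
    HasSum (fun k : ℕ => ∑ l ∈ Finset.range m, s l / (m * k + (a + l)))
      (∫ x in Ioi (0 : ℝ), (∑ l ∈ Finset.range m, s l * Real.exp (-((a + l) * x))) /
        (1 - Real.exp (-(m * x)))) := by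
  have hm0 : (0 : ℝ) < m := by exact_mod_cast hm
  set F : ℕ → ℝ → ℝ := fun k x =>
    ∑ l ∈ Finset.range m, s l * Real.exp (-((m * k + (a + l)) * x)) with hF
  have hpos (k l : ℕ) : 0 < m * k + (a + l) := by positivity
  have hexp {b : ℝ} (hb : 0 < b) :
      Integrable (fun x => Real.exp (-(b * x))) (volume.restrict (Ioi 0)) := by
    simpa only [neg_mul] using! integrableOn_exp_mul_Ioi (neg_lt_zero.2 hb) 0
  have hexp_val {b : ℝ} (hb : 0 < b) : ∫ x in Ioi (0 : ℝ), Real.exp (-(b * x)) = 1 / b := by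
    simpa [neg_mul] using integral_exp_mul_Ioi (neg_lt_zero.2 hb) 0
  have hF_int (k : ℕ) : Integrable (F k) (volume.restrict (Ioi 0)) :=
    integrable_finsetSum _ fun l _ => (hexp (hpos k l)).const_mul _
  have hF_val (k : ℕ) : ∫ x in Ioi (0 : ℝ), F k x =
      ∑ l ∈ Finset.range m, s l / (m * k + (a + l)) := by
    rw [integral_finsetSum _ fun l _ => (hexp (hpos k l)).const_mul _]
    refine Finset.sum_congr rfl fun l _ => ?_
    rw [integral_const_mul, hexp_val (hpos k l), mul_one_div]
  set C : ℝ := ∑ l ∈ Finset.range m, |s l| * l with hC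
  have hC0 : 0 ≤ C := Finset.sum_nonneg fun l _ => by positivity
  have hbound (k : ℕ) {x : ℝ} (hx : 0 < x) :
      ‖F k x‖ ≤ C * (x ^ ((2 : ℝ) - 1) * Real.exp (-((m * k + a) * x))) := by
    have hfac : F k x = Real.exp (-((m * k + a) * x)) *
        ∑ l ∈ Finset.range m, s l * (Real.exp (-(l * x)) - 1) := by
      simp_rw [mul_sub, mul_one]
      rw [Finset.sum_sub_distrib, hs, sub_zero, Finset.mul_sum]
      refine Finset.sum_congr rfl fun l _ => ?_
      rw [mul_left_comm, ← Real.exp_add]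
      ring_nf
    have hsum : ‖∑ l ∈ Finset.range m, s l * (Real.exp (-(l * x)) - 1)‖ ≤ C * x := by
      rw [hC, Finset.sum_mul]
      refine norm_sum_le_of_le _ fun l _ => ?_
      rw [norm_mul, Real.norm_eq_abs, mul_assoc]
      refine mul_le_mul_of_nonneg_left ?_ (abs_nonneg _)
      have h0 : 0 ≤ l * x := by positivity
      have h1 : Real.exp (-(l * x)) ≤ 1 := Real.exp_le_one_iff.2 (neg_nonpos.2 h0)
      rw [Real.norm_eq_abs, abs_of_nonpos (by linarith)]
      linarith [Real.add_one_le_exp (-(l * x))]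
    rw [hfac, norm_mul, Real.norm_of_nonneg (Real.exp_pos _).le, show (2 : ℝ) - 1 = 1 by norm_num,
      Real.rpow_one, ← mul_assoc, mul_comm]
    exact mul_le_mul_of_nonneg_right hsum (Real.exp_pos _).le
  have hq (k : ℕ) : 0 < m * k + a := by positivity
  have hB_int (k : ℕ) : Integrable
      (fun x : ℝ => C * (x ^ ((2 : ℝ) - 1) * Real.exp (-((m * k + a) * x))))
      (volume.restrict (Ioi 0)) := by
    refine Integrable.const_mul ?_ _
    have := integrableOn_rpow_mul_exp_neg_mul_rpow (p := 1) (s := 2 - 1) (b := m * k + a)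
      (by norm_num) one_pos (hq k)
    simpa only [Real.rpow_one, neg_mul] using! this
  have hnorm (k : ℕ) : ∫ x in Ioi (0 : ℝ), ‖F k x‖ ≤ C * (1 / (m * k + a)) ^ 2 := by
    refine (setIntegral_mono_on (hF_int k).norm (hB_int k) measurableSet_Ioi
      fun x hx => hbound k hx).trans (le_of_eq ?_)
    rw [integral_const_mul, Real.integral_rpow_mul_exp_neg_mul_Ioi two_pos (hq k)]
    simp
  have hF_sum : Summable fun k => ∫ x in Ioi (0 : ℝ), ‖F k x‖ := by
    refine Summable.of_nonneg_of_le (fun k => integral_nonneg fun x => norm_nonneg _) hnorm ?_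
    refine Summable.mul_left _ ?_
    have h2 : Summable fun k : ℕ => 1 / |(k : ℝ) + a / m| ^ (2 : ℝ) :=
      (Real.summable_one_div_nat_add_rpow (a / m) 2).2 one_lt_two
    refine (h2.mul_left (1 / (m : ℝ) ^ 2)).congr fun k => ?_
    rw [abs_of_pos (by positivity), Real.rpow_two]
    field_simp
  have h := hasSum_integral_of_summable_integral_norm hF_int hF_sum
  simp_rw [hF_val] at h
  convert! h using 1
  refine setIntegral_congr_fun measurableSet_Ioi fun x hx => ?_
  have hr1 : Real.exp (-(m * x)) < 1 := by
    rw [Real.exp_lt_one_iff, neg_lt_zero]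
    exact mul_pos hm0 hx
  have hgeom := (hasSum_geometric_of_lt_one (Real.exp_pos _).le hr1).mul_left
    (∑ l ∈ Finset.range m, s l * Real.exp (-((a + l) * x)))
  rw [← div_eq_mul_inv] at hgeom
  refine (hgeom.tsum_eq.symm.trans (tsum_congr fun k => ?_))
  rw [hF, Finset.sum_mul, ← Real.exp_nat_mul]
  refine Finset.sum_congr rfl fun l _ => ?_
  rw [mul_assoc, ← Real.exp_add]
  ring_nf

open Set in
/-- Gauss-type integral for a combination of digamma values whose coefficients sum to zero. -/
theorem integral_sum_exp_div_one_sub_exp {m : ℕ} (hm : 0 < m) {a : ℝ} (ha : 0 < a) {s : ℕ → ℝ}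
    (hs : ∑ l ∈ Finset.range m, s l = 0) :
    ∫ x in Ioi (0 : ℝ), (∑ l ∈ Finset.range m, s l * Real.exp (-((a + l) * x))) /
        (1 - Real.exp (-(m * x))) =
      -(1 / m) * ∑ l ∈ Finset.range m,
        s l * (deriv Real.Gamma ((a + l) / m) / Real.Gamma ((a + l) / m)) := by
  have hm0 : (0 : ℝ) < m := by exact_mod_cast hm
  refine tendsto_nhds_unique (hasSum_sum_div_of_sum_eq_zero hm ha hs).tendsto_sum_nat ?_
  have hlim := (tendsto_finsetSum (Finset.range m) fun l _ =>
    (tendsto_sum_inv_sub_log (x := (a + l) / m) (by positivity)).const_mul (s l)).const_mul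
      (1 / (m : ℝ))
  have hval : 1 / (m : ℝ) * ∑ l ∈ Finset.range m,
      s l * -(deriv Real.Gamma ((a + l) / m) / Real.Gamma ((a + l) / m)) =
      -(1 / m) * ∑ l ∈ Finset.range m,
        s l * (deriv Real.Gamma ((a + l) / m) / Real.Gamma ((a + l) / m)) := by
    simp_rw [mul_neg, Finset.sum_neg_distrib]
    ring
  rw [hval] at hlim
  refine hlim.congr fun n => ?_
  simp_rw [mul_sub]
  rw [Finset.sum_sub_distrib, ← Finset.sum_mul, hs, zero_mul, sub_zero, Finset.sum_comm,
    Finset.mul_sum]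
  refine Finset.sum_congr rfl fun l _ => ?_
  rw [Finset.mul_sum, Finset.mul_sum]
  refine Finset.sum_congr rfl fun k _ => ?_
  have : 0 < a + l := by positivity
  have : 0 < a + l + m * k := by positivity
  field_simp
  ring

open Set in
/-- Integrating against the Cauchy kernel amounts to integrating the cosine transform against an
exponential. -/
theorem integral_mul_inv_sq_add_sq {w : ℝ → ℝ} (hw : Integrable w) {b : ℝ} (hb : 0 < b) :
    ∫ t : ℝ, w t / (b ^ 2 + t ^ 2) =
      1 / b * ∫ x in Ioi (0 : ℝ), Real.exp (-(b * x)) * ∫ t : ℝ, w t * Real.cos (x * t) := by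
  have hexp : Integrable (fun x => Real.exp (-(b * x))) (volume.restrict (Ioi 0)) := by
    simpa only [neg_mul] using! integrableOn_exp_mul_Ioi (neg_lt_zero.2 hb) 0
  have hint : Integrable
      (Function.uncurry fun t x : ℝ => w t * (Real.exp (-(b * x)) * Real.cos (x * t)))
      (volume.prod (volume.restrict (Ioi 0))) := by
    have h := (hw.mul_prod hexp).mul_bdd (c := 1) (g := fun z : ℝ × ℝ => Real.cos (z.2 * z.1))
      (by fun_prop) (Filter.Eventually.of_forall fun z => Real.abs_cos_le_one _)
    refine h.congr (Filter.Eventually.of_forall fun z => ?_)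
    simp only [Function.uncurry]
    ring
  have h := integral_integral_swap hint
  simp_rw [integral_const_mul, integral_exp_neg_mul_cos_Ioi hb] at h
  have hl (t : ℝ) : w t / (b ^ 2 + t ^ 2) = 1 / b * (w t * (b / (b ^ 2 + t ^ 2))) := by
    field_simp
  simp_rw [hl, integral_const_mul, h, ← integral_const_mul]
  congr 2
  funext x
  congr 2
  funext t
  ring

/-- Elliptic orbital integral in terms of the digamma function ψ(x) = Γ′(x)/Γ(x). -/
theorem elliptic_orbital_integral (m : ℕ) (hm : 2 ≤ m) (j : ℕ) (hj1 : 1 ≤ j)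
    (hj2 : j ≤ m - 1) (α : ℝ) (hα : 1 < α) :
    Integrable (fun t : ℝ =>
      Real.exp (-2 * Real.pi * (j : ℝ) * t / (m : ℝ)) /
        (((α - 1 / 2) ^ 2 + t ^ 2) * (1 + Real.exp (-2 * Real.pi * t)))) ∧
    (∫ t : ℝ,
        Real.exp (-2 * Real.pi * (j : ℝ) * t / (m : ℝ)) /
          (((α - 1 / 2) ^ 2 + t ^ 2) * (1 + Real.exp (-2 * Real.pi * t)))) =
      2 / ((1 - 2 * α) * (m : ℝ)) *
        ∑ l ∈ Finset.range m,
          Real.sin ((2 * (l : ℝ) + 1) * (j : ℝ) * Real.pi / (m : ℝ)) *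
            (deriv Real.Gamma ((α + (l : ℝ)) / (m : ℝ)) / Real.Gamma ((α + (l : ℝ)) / (m : ℝ))) := by
  have hjm : j < m := by omega
  have hm' : 0 < m := by omega
  have hm0 : (0 : ℝ) < m := by exact_mod_cast hm'
  have hb : 0 < α - 1 / 2 := by linarith
  have hc0 : (0 : ℝ) < j / m := div_pos (by exact_mod_cast hj1) hm0
  have hc1 : (j : ℝ) / m < 1 := (div_lt_one hm0).2 (by exact_mod_cast hjm)
  set w : ℝ → ℝ := fun t =>
    Real.exp (-2 * Real.pi * (j / m : ℝ) * t) / (1 + Real.exp (-2 * Real.pi * t)) with hw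
  have hweq : (fun t : ℝ => Real.exp (-2 * Real.pi * (j : ℝ) * t / (m : ℝ)) /
      (((α - 1 / 2) ^ 2 + t ^ 2) * (1 + Real.exp (-2 * Real.pi * t)))) =
      fun t => w t / ((α - 1 / 2) ^ 2 + t ^ 2) := by
    funext t
    rw [hw, div_div, mul_comm ((α - 1 / 2) ^ 2 + t ^ 2)]
    congr 2
    ring
  have hw_int : Integrable w := by
    simpa only [zero_mul, Real.cos_zero, mul_one] using
      (integrable_and_integral_exp_div_one_add_exp_mul_cos hc0 hc1 0).1
  rw [hweq]
  constructor
  · simp_rw [div_eq_mul_inv (w _)]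
    refine hw_int.mul_bdd (c := ((α - 1 / 2) ^ 2)⁻¹) (by fun_prop)
      (Filter.Eventually.of_forall fun t => ?_)
    rw [Real.norm_of_nonneg (by positivity)]
    exact inv_anti₀ (by positivity) (le_add_of_nonneg_right (sq_nonneg t))
  · rw [integral_mul_inv_sq_add_sq hw_int hb]
    have hinner : ∫ x in Set.Ioi (0 : ℝ), Real.exp (-((α - 1 / 2) * x)) *
        ∫ t : ℝ, w t * Real.cos (x * t) =
        ∫ x in Set.Ioi (0 : ℝ), (∑ l ∈ Finset.range m,
          Real.sin ((2 * l + 1) * j * Real.pi / m) * Real.exp (-((α + l) * x))) /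
            (1 - Real.exp (-(m * x))) := by
      refine setIntegral_congr_fun measurableSet_Ioi fun x hx => ?_
      simp only [hw]
      rw [(integrable_and_integral_exp_div_one_add_exp_mul_cos hc0 hc1 x).2,
        re_one_div_two_mul_sin hm' hx, mul_div_assoc', Finset.mul_sum]
      congr 1
      refine Finset.sum_congr rfl fun l _ => ?_
      rw [mul_left_comm, ← Real.exp_add]
      ring_nf
    rw [hinner, integral_sum_exp_div_one_sub_exp hm' (by linarith)
      (sum_sin_odd_mul_eq_zero hj1 hjm), ← mul_assoc]
    congr 1
    have h1 : 2 * α - 1 ≠ 0 := by linarith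
    have h2 : α - 1 / 2 = (2 * α - 1) / 2 := by ring
    rw [h2, ← neg_sub (2 * α) 1]
    field_simp
end
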